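/- arXiv:2111.15469 — 4 statements merged into one kernel-verified Lean document; each statement's English description precedes it below -/
import Mathlib

section
/- Let {f_n} be a sequence of nonnegative measurable functions on a probability space (Ω, F, P). There exist a strictly increasing sequence of indices n_1 < n_2 < ⋯ and measurable functions f^{(k)} : Ω → [0, ∞) (k ∈ ℕ) such that for every k the truncations f_{n_j}^{(k)} := f_{n_j} · 1_{{k−1 ≤ f_{n_j} < k}} converge hereditarily in Cesàro mean to f^{(k)} P-a.e., and such that, setting f := Σ_{k∈ℕ} f^{(k)} (with values in [0, ∞]), the following holds: if lim_{K→∞} limsup_{j→∞} P(f_{n_j} ≥ K and f < ∞) = 0, then the subsequence {f_{n_j}} converges hereditarily in Cesàro mean to f, P-a.e. -/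
open MeasureTheory Filter Finset
open scoped ENNReal

/-- The truncation `f^(k) = f · 1_{k-1 ≤ f < k}` of a function `f`. -/
noncomputable def trunc {Ω : Type*} (g : Ω → ℝ) (k : ℕ) : Ω → ℝ :=
  ({ω | (k : ℝ) - 1 ≤ g ω ∧ g ω < k}).indicator g

/-- Weak sequential compactness of bounded sequences in a Hilbert space, simultaneously for
countably many sequences. -/
theorem exists_subseq_tendsto_inner {H ι : Type*} [NormedAddCommGroup H] [InnerProductSpace ℝ H]
    [CompleteSpace H] [Countable ι] (x : ι → ℕ → H) (C : ι → ℝ) (hC : ∀ i n, ‖x i n‖ ≤ C i) :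
    ∃ φ : ℕ → ℕ, StrictMono φ ∧ ∃ y : ι → H, ∀ i z,
      Tendsto (fun n => inner ℝ (x i (φ n)) z) atTop (nhds (inner ℝ (y i) z)) := by
  obtain ⟨a, -, φ, hφ, ha⟩ := (isCompact_univ_pi fun p : ι × ι × ℕ =>
    isCompact_Icc (a := -(C p.1 * C p.2.1)) (b := C p.1 * C p.2.1)).isSeqCompact
    (x := fun n p => inner ℝ (x p.1 n) (x p.2.1 p.2.2)) (fun n p _ => by
      change inner ℝ (x p.1 n) (x p.2.1 p.2.2) ∈ Set.Icc _ _
      rw [Set.mem_Icc, ← abs_le]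
      refine (abs_real_inner_le_norm _ _).trans ?_
      gcongr
      · exact (norm_nonneg _).trans (hC p.1 n)
      · exact hC _ _
      · exact hC _ _)
  rw [tendsto_pi_nhds] at ha
  have key : ∀ i z, ∃ l, Tendsto (fun n => inner ℝ (x i (φ n)) z) atTop (nhds l) := by
    intro i z
    have hspan : ∀ v ∈ Submodule.span ℝ (Set.range (x i)),
        ∃ l, Tendsto (fun n => inner ℝ (x i (φ n)) v) atTop (nhds l) := by
      intro v hv
      induction hv using Submodule.span_induction with
      | mem v hv =>
        obtain ⟨m, rfl⟩ := hv
        exact ⟨_, ha (i, i, m)⟩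
      | zero => exact ⟨0, by simp⟩
      | add u v _ _ hu hv =>
        obtain ⟨l, hl⟩ := hu
        obtain ⟨l', hl'⟩ := hv
        exact ⟨l + l', by simpa only [inner_add_right] using hl.add hl'⟩
      | smul c v _ hv =>
        obtain ⟨l, hl⟩ := hv
        exact ⟨c * l, by simpa only [inner_smul_right] using hl.const_mul c⟩
    obtain ⟨u, hu, v, hv, rfl⟩ := Submodule.exists_add_mem_mem_orthogonal
      (K := (Submodule.span ℝ (Set.range (x i))).topologicalClosure) z
    have hv0 : ∀ n, inner ℝ (x i n) v = 0 := fun n => hv _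
      (Submodule.le_topologicalClosure _ (Submodule.subset_span ⟨n, rfl⟩))
    simp only [inner_add_right, hv0, add_zero]
    refine cauchySeq_tendsto_of_complete (Metric.cauchySeq_iff.2 fun ε hε => ?_)
    have hC0 : 0 ≤ C i := (norm_nonneg _).trans (hC i 0)
    obtain ⟨w, hw, hwu⟩ := Metric.mem_closure_iff.1 hu (ε / (4 * (C i + 1))) (by positivity)
    obtain ⟨l, hl⟩ := hspan w hw
    obtain ⟨N, hN⟩ := Metric.cauchySeq_iff.1 hl.cauchySeq (ε / 2) (by positivity)
    refine ⟨N, fun m hm n hn => ?_⟩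
    have hclose : ∀ k, |inner ℝ (x i k) u - inner ℝ (x i k) w| < ε / 4 := by
      intro k
      rw [← inner_sub_right]
      rw [dist_eq_norm] at hwu
      calc |inner ℝ (x i k) (u - w)| ≤ ‖x i k‖ * ‖u - w‖ := abs_real_inner_le_norm _ _
        _ ≤ C i * ‖u - w‖ := by gcongr; exact hC i k
        _ ≤ (C i + 1) * ‖u - w‖ := by gcongr; linarith
        _ < (C i + 1) * (ε / (4 * (C i + 1))) := by gcongr
        _ = ε / 4 := by field_simp
    have h1 := abs_lt.1 (hclose (φ m))
    have h2 := abs_lt.1 (hclose (φ n))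
    have h3 := hN m hm n hn
    rw [Real.dist_eq, abs_lt] at h3 ⊢
    constructor <;> linarith [h1.1, h1.2, h2.1, h2.2, h3.1, h3.2]
  choose L hL using key
  refine ⟨φ, hφ, fun i => (InnerProductSpace.toDual ℝ H).symm
    (continuousLinearMapOfTendsto (fun n => innerSL ℝ (x i (φ n))) (f := L i)
      (tendsto_pi_nhds.2 fun z => by simpa using hL i z)), fun i z => ?_⟩
  rw [InnerProductSpace.toDual_symm_apply]
  exact hL i z

/-- Countably many uniformly bounded sequences of nonnegative measurable functions converge weakly
in `L²` along a common subsequence, to nonnegative measurable limits. -/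
theorem exists_subseq_weak_limit {Ω ι : Type*} [Countable ι] [MeasurableSpace Ω] (P : Measure Ω)
    [IsProbabilityMeasure P] (u : ι → ℕ → Ω → ℝ) (C : ι → ℝ) (hu : ∀ i n, Measurable (u i n))
    (h0 : ∀ i n ω, 0 ≤ u i n ω) (hC : ∀ i n ω, u i n ω ≤ C i) :
    ∃ φ : ℕ → ℕ, StrictMono φ ∧ ∃ F : ι → Ω → ℝ, (∀ i, Measurable (F i)) ∧
      (∀ i ω, 0 ≤ F i ω) ∧ (∀ i, MemLp (F i) 2 P) ∧
      ∀ i Z, MemLp Z 2 P →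
        Tendsto (fun n => ∫ ω, u i (φ n) ω * Z ω ∂P) atTop (nhds (∫ ω, F i ω * Z ω ∂P)) := by
  have hL : ∀ i n, MemLp (u i n) 2 P := fun i n =>
    MemLp.of_bound (hu i n).aestronglyMeasurable (C i) (.of_forall fun ω => by
      rw [Real.norm_eq_abs, abs_of_nonneg (h0 i n ω)]; exact hC i n ω)
  obtain ⟨φ, hφ, y, hy⟩ := exists_subseq_tendsto_inner (fun i n => (hL i n).toLp) C (fun i n => by
    have := Lp.norm_le_of_ae_bound (p := 2) (μ := P) (f := (hL i n).toLp) (C := C i)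
      ((h0 i n (Classical.choice (nonempty_of_isProbabilityMeasure P))).trans (hC i n _))
      ((hL i n).coeFn_toLp.mono fun ω hω => by
        rw [hω, Real.norm_eq_abs, abs_of_nonneg (h0 i n ω)]; exact hC i n ω)
    simpa [measureUnivNNReal] using this)
  have hy' : ∀ i Z, MemLp Z 2 P →
      Tendsto (fun n => ∫ ω, u i (φ n) ω * Z ω ∂P) atTop (nhds (∫ ω, y i ω * Z ω ∂P)) := by
    intro i Z hZ
    have h := hy i hZ.toLp
    simp only [L2.inner_def] at h
    convert h using 1
    · ext n
      refine integral_congr_ae ?_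
      filter_upwards [(hL i (φ n)).coeFn_toLp, hZ.coeFn_toLp] with ω h1 h2
      rw [h1, h2]
      simp [mul_comm]
    · congr 1
      refine integral_congr_ae ?_
      filter_upwards [hZ.coeFn_toLp] with ω h2
      rw [h2]
      simp [mul_comm]
  have hpos : ∀ i, 0 ≤ᵐ[P] y i := by
    intro i
    refine ae_nonneg_of_forall_setIntegral_nonneg ((Lp.memLp (y i)).integrable (by norm_num)) ?_
    intro s hs _
    have h := hy' i (s.indicator 1) ((memLp_const 1).indicator hs)
    have hind : ∀ v : Ω → ℝ, ∫ ω, v ω * s.indicator 1 ω ∂P = ∫ ω in s, v ω ∂P := by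
      intro v
      rw [← integral_indicator hs]
      congr 1
      ext ω
      by_cases hω : ω ∈ s <;> simp [hω]
    rw [hind] at h
    refine ge_of_tendsto' h fun n => integral_nonneg fun ω => ?_
    exact mul_nonneg (h0 _ _ _) (Set.indicator_nonneg (fun _ _ => zero_le_one) _)
  have hae : ∀ i, (fun ω => max ((Lp.aestronglyMeasurable (y i)).mk (y i) ω) 0) =ᵐ[P] y i := by
    intro i
    filter_upwards [(Lp.aestronglyMeasurable (y i)).ae_eq_mk, hpos i] with ω h1 h2
    rw [← h1]
    exact max_eq_left h2
  refine ⟨φ, hφ, fun i ω => max ((Lp.aestronglyMeasurable (y i)).mk (y i) ω) 0,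
    fun i => ((Lp.aestronglyMeasurable (y i)).stronglyMeasurable_mk.measurable).max
      measurable_const, fun i ω => le_max_right _ _,
    fun i => (memLp_congr_ae (hae i)).2 (Lp.memLp _), fun i Z hZ => ?_⟩
  convert hy' i Z hZ using 2
  refine integral_congr_ae ?_
  filter_upwards [hae i] with ω h
  rw [h]

theorem exists_strictMono_forall_lt {R : ℕ → ℕ → Prop} {Q : ℕ → ℕ → ℕ → Prop}
    (hR : ∀ I, ∀ᶠ N in atTop, R I N) (hQ : ∀ I m, ∀ᶠ N in atTop, Q I m N) :
    ∃ n : ℕ → ℕ, StrictMono n ∧ (∀ I, R I (n I)) ∧ ∀ i I, i < I → Q I (n i) (n I) := by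
  have h : ∀ I M, ∃ N, M < N ∧ R I N ∧ ∀ m ∈ Set.Iic M, Q I m N := fun I M =>
    ((eventually_gt_atTop M).and ((hR I).and
      ((eventually_all_finite (Set.finite_Iic M)).2 fun m _ => hQ I m))).exists
  choose g hg hgR hgQ using h
  let n : ℕ → ℕ := fun I => Nat.rec (g 0 0) (fun I M => g (I + 1) M) I
  have hn : StrictMono n := strictMono_nat_of_lt_succ fun I => hg (I + 1) (n I)
  refine ⟨n, hn, fun I => ?_, fun i I hi => ?_⟩
  · cases I with
    | zero => exact hgR 0 0
    | succ I => exact hgR (I + 1) (n I)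
  · cases I with
    | zero => omega
    | succ I => exact hgQ (I + 1) (n I) (n i) (hn.monotone (Nat.lt_succ_iff.1 hi))

theorem ae_tendsto_zero_of_summable_integral {Ω : Type*} [MeasurableSpace Ω] {P : Measure Ω}
    {Y : ℕ → Ω → ℝ} (hY : ∀ n, Integrable (Y n) P) (h0 : ∀ n ω, 0 ≤ Y n ω)
    (hsum : Summable fun n => ∫ ω, Y n ω ∂P) :
    ∀ᵐ ω ∂P, Tendsto (fun n => Y n ω) atTop (nhds 0) := by
  have hfin : ∫⁻ ω, ∑' n, ENNReal.ofReal (Y n ω) ∂P ≠ ⊤ := by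
    rw [lintegral_tsum fun n => (hY n).1.aemeasurable.ennreal_ofReal]
    simp_rw [← ofReal_integral_eq_lintegral_ofReal (hY _) (.of_forall (h0 _))]
    exact hsum.tsum_ofReal_ne_top
  filter_upwards [ae_lt_top' (AEMeasurable.tsum
    fun n => (hY n).1.aemeasurable.ennreal_ofReal) hfin] with ω hω
  have h := (ENNReal.tendsto_toReal ENNReal.zero_ne_top).comp
    (ENNReal.tendsto_atTop_zero_of_tsum_ne_top hω.ne)
  simpa [Function.comp_def, ENNReal.toReal_ofReal (h0 _ ω)] using h

theorem summable_div_floor_pow_sq {b D : ℕ → ℝ} (hb : ∀ j, 0 ≤ b j) (hD0 : ∀ N, 0 ≤ D N)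
    (hD : ∀ N, D N ≤ ∑ j ∈ range N, b j) (hsum : Summable fun j : ℕ => b j / ((j : ℝ) + 1) ^ 2)
    {c : ℝ} (hc : 1 < c) : Summable fun n : ℕ => D ⌊c ^ n⌋₊ / (⌊c ^ n⌋₊ : ℝ) ^ 2 := by
  set k : ℕ → ℕ := fun n => ⌊c ^ n⌋₊
  set A := c ^ 5 * (c - 1)⁻¹ ^ 3
  have hA : 0 ≤ A := by have := sub_pos.2 hc; positivity
  refine summable_of_sum_range_le (c := ∑' j : ℕ, 4 * A * (b j / ((j : ℝ) + 1) ^ 2))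
    (fun n => div_nonneg (hD0 _) (sq_nonneg _)) fun N => ?_
  set M := ∑ n ∈ range N, k n
  calc ∑ n ∈ range N, D (k n) / (k n : ℝ) ^ 2
      ≤ ∑ n ∈ range N, ∑ j ∈ range M, if j < k n then b j * (1 / (k n : ℝ) ^ 2) else 0 := by
        refine sum_le_sum fun n hn => ?_
        have hk : k n ≤ M := single_le_sum (f := k) (fun _ _ => Nat.zero_le _) hn
        rw [← sum_filter]
        have : (range M).filter (fun j => j < k n) = range (k n) := by
          ext j; simp only [mem_filter, Finset.mem_range]; omega
        rw [this, ← sum_mul, mul_one_div]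
        gcongr
        exact hD _
    _ = ∑ j ∈ range M, b j * ∑ n ∈ range N with j < k n, 1 / (k n : ℝ) ^ 2 := by
        rw [sum_comm]
        refine sum_congr rfl fun j _ => ?_
        rw [sum_filter, mul_sum]
        exact sum_congr rfl fun n _ => by split_ifs <;> simp
    _ ≤ ∑ j ∈ range M, 4 * A * (b j / ((j : ℝ) + 1) ^ 2) := by
        refine sum_le_sum fun j _ => ?_
        have h1 : ∑ n ∈ range N with j < k n, 1 / (k n : ℝ) ^ 2 ≤ A / ((j : ℝ) + 1 / 2) ^ 2 := by
          refine le_trans (sum_le_sum_of_subset_of_nonneg ?_ fun _ _ _ => by positivity)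
            (sum_div_nat_floor_pow_sq_le_div_sq N (j := (j : ℝ) + 1 / 2) (by positivity) hc)
          intro n hn
          rw [mem_filter] at hn ⊢
          refine ⟨hn.1, ?_⟩
          have : ((j + 1 : ℕ) : ℝ) ≤ k n := Nat.cast_le.2 hn.2
          push_cast at this
          linarith
        have h2 : A / ((j : ℝ) + 1 / 2) ^ 2 ≤ 4 * A / ((j : ℝ) + 1) ^ 2 := by
          rw [div_le_div_iff₀ (by positivity) (by positivity)]
          have : ((j : ℝ) + 1) ^ 2 ≤ 4 * ((j : ℝ) + 1 / 2) ^ 2 := by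
            nlinarith [Nat.cast_nonneg (α := ℝ) j]
          nlinarith
        calc _ ≤ b j * (4 * A / ((j : ℝ) + 1) ^ 2) :=
              mul_le_mul_of_nonneg_left (h1.trans h2) (hb j)
          _ = _ := by ring
    _ ≤ _ := (hsum.mul_left _).sum_le_tsum _ fun j _ => by have := hb j; positivity

/-- A strong law of large numbers, after Etemadi, for nonnegative square-integrable functions `h j`
whose deviations from given centerings `s j` are almost orthogonal. -/
theorem ae_tendsto_cesaro_of_almost_orthogonal {Ω : Type*} [MeasurableSpace Ω] {P : Measure Ω}
    {h s : ℕ → Ω → ℝ} (hh : ∀ j, MemLp (h j) 2 P) (hs : ∀ j, MemLp (s j) 2 P)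
    (h0 : ∀ j ω, 0 ≤ h j ω) {L : ℕ}
    (hcov : ∀ l ≥ L, ∀ j < l, ∫ ω, (h j ω - s j ω) * (h l ω - s l ω) ∂P ≤ 1 / ((l : ℝ) + 1))
    {v : ℕ → ℝ} (hv : ∀ j, ∫ ω, (h j ω - s j ω) ^ 2 ∂P ≤ v j)
    (hsum : Summable fun j : ℕ => v j / ((j : ℝ) + 1) ^ 2) {S : Ω → ℝ}
    (hS : ∀ᵐ ω ∂P, Tendsto (fun J : ℕ => (∑ j ∈ range J, s j ω) / J) atTop (nhds (S ω))) :
    ∀ᵐ ω ∂P, Tendsto (fun J : ℕ => (∑ j ∈ range J, h j ω) / J) atTop (nhds (S ω)) := by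
  have hX : ∀ j, MemLp (fun ω => h j ω - s j ω) 2 P := fun j => (hh j).sub (hs j)
  have hXs : ∀ N, MemLp (fun ω => ∑ j ∈ range N, (h j ω - s j ω)) 2 P := fun N =>
    memLp_finsetSum _ fun j _ => hX j
  have hv0 : ∀ j, 0 ≤ v j := fun j => (integral_nonneg fun ω => sq_nonneg _).trans (hv j)
  set D : ℕ → ℝ := fun N => ∫ ω, (∑ j ∈ range N, (h j ω - s j ω)) ^ 2 ∂P with hDdef
  have hD0 : ∀ N, 0 ≤ D N := fun N => integral_nonneg fun ω => sq_nonneg _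
  have hstep : ∀ N, L ≤ N → D (N + 1) ≤ D N + (v N + 2) := by
    intro N hN
    have hprod : ∀ j, Integrable (fun ω => (h j ω - s j ω) * (h N ω - s N ω)) P :=
      fun j => (hX j).integrable_mul (hX N)
    have hexp : D (N + 1) = D N + 2 * ∑ j ∈ range N,
        ∫ ω, (h j ω - s j ω) * (h N ω - s N ω) ∂P + ∫ ω, (h N ω - s N ω) ^ 2 ∂P := by
      rw [← integral_finsetSum _ fun j _ => hprod j, ← integral_const_mul, hDdef]
      simp only
      have hcross : Integrable (fun ω => 2 * ∑ j ∈ range N,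
          (h j ω - s j ω) * (h N ω - s N ω)) P :=
        (integrable_finsetSum _ fun j _ => hprod j).const_mul 2
      have hsq : Integrable (fun ω => (∑ j ∈ range N, (h j ω - s j ω)) ^ 2 + 2 * ∑ j ∈ range N,
          (h j ω - s j ω) * (h N ω - s N ω)) P := (hXs N).integrable_sq.add hcross
      rw [← integral_add (hXs N).integrable_sq hcross, ← integral_add hsq (hX N).integrable_sq]
      congr 1
      ext ω
      rw [sum_range_succ, ← sum_mul]
      ring
    have hle : ∑ j ∈ range N, ∫ ω, (h j ω - s j ω) * (h N ω - s N ω) ∂P ≤ 1 :=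
      calc _ ≤ ∑ j ∈ range N, 1 / ((N : ℝ) + 1) :=
            sum_le_sum fun j hj => hcov N hN j (Finset.mem_range.1 hj)
        _ = N / ((N : ℝ) + 1) := by simp [div_eq_mul_inv]
        _ ≤ 1 := by rw [div_le_one (by positivity)]; linarith
    rw [hexp]
    linarith [hv N]
  set C := ∑ i ∈ range (L + 1), D i
  have hC0 : 0 ≤ C := sum_nonneg fun i _ => hD0 i
  have hDC : ∀ N, D N ≤ C + ∑ j ∈ range N, (v j + 2) := by
    intro N
    have hsmall : ∀ i ≤ L, D i ≤ C + ∑ j ∈ range i, (v j + 2) := fun i hi =>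
      (single_le_sum (fun i _ => hD0 i) (Finset.mem_range.2 (Nat.lt_succ_of_le hi))).trans
        (le_add_of_nonneg_right (sum_nonneg fun j _ => by linarith [hv0 j]))
    rcases le_total N L with hN | hN
    · exact hsmall N hN
    · induction N, hN using Nat.le_induction with
      | base => exact hsmall L le_rfl
      | succ N hN ih =>
        rw [sum_range_succ]
        linarith [hstep N hN]
  set b : ℕ → ℝ := fun j => v j + 2 + if j = 0 then C else 0
  have hb0 : ∀ j, 0 ≤ b j := fun j => by
    have := hv0 j
    simp only [b]
    split_ifs <;> linarith
  have hDb : ∀ N, D N ≤ ∑ j ∈ range N, b j := by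
    intro N
    rcases Nat.eq_zero_or_pos N with rfl | hN
    · simp [hDdef]
    · rw [sum_add_distrib, sum_ite_eq' (range N) 0, if_pos (Finset.mem_range.2 hN), add_comm]
      exact hDC N
  have hbsum : Summable fun j : ℕ => b j / ((j : ℝ) + 1) ^ 2 := by
    have h2 : Summable fun j : ℕ => 2 / ((j : ℝ) + 1) ^ 2 := by
      have := ((summable_nat_add_iff 1).2
        (Real.summable_one_div_nat_pow.2 (by norm_num : 1 < 2))).mul_left 2
      simpa [div_eq_mul_inv] using this
    have h3 : Summable fun j : ℕ => (if j = 0 then C else 0) / ((j : ℝ) + 1) ^ 2 :=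
      summable_of_ne_finset_zero (s := {0}) fun j hj => by
        simp [Finset.notMem_singleton.1 hj]
    exact ((hsum.add h2).add h3).congr fun j => by simp only [b]; ring
  set c : ℕ → ℝ := fun m => 1 + 1 / ((m : ℝ) + 1)
  have hc1 : ∀ m, 1 < c m := fun m => by
    have : (0 : ℝ) < 1 / ((m : ℝ) + 1) := by positivity
    simp only [c]; linarith
  have hclim : Tendsto c atTop (nhds 1) := by
    simpa [c] using (tendsto_one_div_add_atTop_nhds_zero_nat (𝕜 := ℝ)).const_add 1
  have hdev : ∀ᵐ ω ∂P, ∀ m, Tendsto (fun n : ℕ =>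
      ((∑ j ∈ range ⌊c m ^ n⌋₊, (h j ω - s j ω)) / (⌊c m ^ n⌋₊ : ℝ)) ^ 2) atTop (nhds 0) := by
    refine ae_all_iff.2 fun m => ae_tendsto_zero_of_summable_integral ?_
      (fun _ _ => sq_nonneg _) ?_
    · intro n
      simp only [div_pow]
      exact (hXs _).integrable_sq.div_const _
    · simp only [div_pow, integral_div]
      exact summable_div_floor_pow_sq hb0 hD0 hDb hbsum (hc1 m)
  filter_upwards [hdev, hS] with ω hω hSω
  refine tendsto_div_of_monotone_of_tendsto_div_floor_pow _ _ ?_ c hc1 hclim fun m => ?_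
  · exact monotone_nat_of_le_succ fun n => by
      rw [sum_range_succ]; linarith [h0 n ω]
  · have hz : Tendsto (fun n : ℕ =>
        (∑ j ∈ range ⌊c m ^ n⌋₊, (h j ω - s j ω)) / (⌊c m ^ n⌋₊ : ℝ)) atTop (nhds 0) := by
      rw [tendsto_zero_iff_abs_tendsto_zero]
      have := (hω m).sqrt
      simpa [Real.sqrt_sq_eq_abs, Function.comp_def] using this
    have hk : Tendsto (fun n : ℕ => ⌊c m ^ n⌋₊) atTop atTop :=
      tendsto_nat_floor_atTop.comp (tendsto_pow_atTop_atTop_of_one_lt (hc1 m))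
    have := hz.add (hSω.comp hk)
    rw [zero_add] at this
    refine this.congr fun n => ?_
    simp only [Function.comp_apply]
    rw [← add_div, sum_sub_distrib, sub_add_cancel]

section Truncation

variable {Ω : Type*} {g : Ω → ℝ}

theorem trunc_nonneg (hg : ∀ ω, 0 ≤ g ω) (k : ℕ) (ω : Ω) : 0 ≤ trunc g k ω :=
  Set.indicator_nonneg (fun ω _ => hg ω) ω

theorem trunc_le (g : Ω → ℝ) (k : ℕ) (ω : Ω) : trunc g k ω ≤ k :=
  Set.indicator_le' (fun _ h => h.2.le) (fun _ _ => Nat.cast_nonneg k) ω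

theorem measurable_trunc [MeasurableSpace Ω] (hg : Measurable g) (k : ℕ) :
    Measurable (trunc g k) :=
  hg.indicator ((measurableSet_le measurable_const hg).inter (measurableSet_lt hg measurable_const))

theorem memLp_trunc [MeasurableSpace Ω] {P : Measure Ω} [IsFiniteMeasure P] (hg : Measurable g)
    (h0 : ∀ ω, 0 ≤ g ω) (k : ℕ) : MemLp (trunc g k) 2 P :=
  MemLp.of_bound (measurable_trunc hg k).aestronglyMeasurable k (.of_forall fun ω => by
    rw [Real.norm_eq_abs, abs_of_nonneg (trunc_nonneg h0 k ω)]; exact trunc_le g k ω)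

theorem trunc_succ_apply (g : Ω → ℝ) (k : ℕ) (ω : Ω) :
    trunc g (k + 1) ω = if (k : ℝ) ≤ g ω ∧ g ω < k + 1 then g ω else 0 := by
  simp [trunc, Set.indicator_apply]

theorem sum_trunc (hg : ∀ ω, 0 ≤ g ω) (q : ℕ) (ω : Ω) :
    ∑ k ∈ range q, trunc g (k + 1) ω = if g ω < q then g ω else 0 := by
  induction q with
  | zero => simp [(hg ω).not_gt]
  | succ q ih =>
    rw [sum_range_succ, ih, trunc_succ_apply]
    push_cast
    split_ifs <;> grind

theorem sq_sum_trunc_le (hg : ∀ ω, 0 ≤ g ω) (q : ℕ) (ω : Ω) :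
    (∑ k ∈ range q, trunc g (k + 1) ω) ^ 2 ≤
      ∑ k ∈ range q, ((k : ℝ) + 1) * trunc g (k + 1) ω := by
  induction q with
  | zero => simp
  | succ q ih =>
    have hprod : (∑ k ∈ range q, trunc g (k + 1) ω) * trunc g (q + 1) ω = 0 := by
      rw [sum_trunc hg, trunc_succ_apply]
      split_ifs <;> grind
    have hle := trunc_le g (q + 1) ω
    push_cast at hle
    rw [sum_range_succ, sum_range_succ]
    nlinarith [mul_le_mul_of_nonneg_right hle (trunc_nonneg hg (q + 1) ω)]

theorem indicator_le_sum_trunc (hg : ∀ ω, 0 ≤ g ω) {q L : ℕ} (hq : 1 ≤ q) (ω : Ω) :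
    {ω | (q : ℝ) ≤ g ω}.indicator (fun _ => (1 : ℝ)) ω ≤
      ∑ k ∈ Ico q L, trunc g (k + 1) ω / k +
        {ω | (L : ℝ) ≤ g ω}.indicator (fun _ => (1 : ℝ)) ω := by
  have hterm : ∀ k ∈ Ico q L, 0 ≤ trunc g (k + 1) ω / k := fun k _ =>
    div_nonneg (trunc_nonneg hg _ _) (Nat.cast_nonneg k)
  have hL0 : 0 ≤ {ω | (L : ℝ) ≤ g ω}.indicator (fun _ => (1 : ℝ)) ω :=
    Set.indicator_nonneg (fun _ _ => zero_le_one) _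
  by_cases hqg : (q : ℝ) ≤ g ω
  · rw [Set.indicator_of_mem (show ω ∈ {ω | (q : ℝ) ≤ g ω} from hqg)]
    by_cases hLg : (L : ℝ) ≤ g ω
    · rw [Set.indicator_of_mem (show ω ∈ {ω | (L : ℝ) ≤ g ω} from hLg)]
      linarith [sum_nonneg hterm]
    · have hk : ⌊g ω⌋₊ ∈ Ico q L :=
        Finset.mem_Ico.2 ⟨Nat.le_floor hqg, (Nat.floor_lt (hg ω)).2 (not_le.1 hLg)⟩
      have hk0 : (0 : ℝ) < ⌊g ω⌋₊ := Nat.cast_pos.2 (hq.trans (Finset.mem_Ico.1 hk).1)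
      have h1 : 1 ≤ trunc g (⌊g ω⌋₊ + 1) ω / ⌊g ω⌋₊ := by
        rw [trunc_succ_apply, if_pos ⟨Nat.floor_le (hg ω), Nat.lt_floor_add_one _⟩,
          one_le_div hk0]
        exact Nat.floor_le (hg ω)
      linarith [single_le_sum hterm hk]
  · rw [Set.indicator_of_notMem (show ω ∉ {ω | (q : ℝ) ≤ g ω} from hqg)]
    exact add_nonneg (sum_nonneg hterm) hL0

end Truncation

theorem summable_sum_mul_div_sq {a : ℕ → ℝ} {B : ℝ} (ha : ∀ k, 0 ≤ a k)
    (hB : ∀ N, ∑ k ∈ range N, a k ≤ B) :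
    Summable fun j : ℕ => (∑ k ∈ range (j + 1), ((k : ℝ) + 1) * a k) / ((j : ℝ) + 1) ^ 2 := by
  refine summable_of_sum_range_le (c := 2 * B)
    (fun j => div_nonneg (sum_nonneg fun k _ => mul_nonneg (by positivity) (ha k))
      (by positivity)) fun N => ?_
  calc ∑ j ∈ range N, (∑ k ∈ range (j + 1), ((k : ℝ) + 1) * a k) / ((j : ℝ) + 1) ^ 2
      = ∑ j ∈ range N, ∑ k ∈ range N,
          if k ≤ j then ((k : ℝ) + 1) * a k * (((j : ℝ) + 1) ^ 2)⁻¹ else 0 := by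
        refine sum_congr rfl fun j hj => ?_
        rw [← sum_filter, div_eq_mul_inv, sum_mul]
        refine sum_congr ?_ fun _ _ => rfl
        ext k
        simp only [mem_filter, Finset.mem_range] at hj ⊢
        omega
    _ = ∑ k ∈ range N, ((k : ℝ) + 1) * a k *
          ∑ j ∈ range N with k ≤ j, (((j : ℝ) + 1) ^ 2)⁻¹ := by
        rw [sum_comm]
        refine sum_congr rfl fun k _ => ?_
        rw [sum_filter, mul_sum]
        exact sum_congr rfl fun j _ => by split_ifs <;> simp
    _ ≤ ∑ k ∈ range N, 2 * a k := by
        refine sum_le_sum fun k _ => ?_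
        have h : ∑ j ∈ range N with k ≤ j, (((j : ℝ) + 1) ^ 2)⁻¹ ≤ 2 / ((k : ℝ) + 1) := by
          refine le_trans (le_of_eq ?_) (sum_Ioo_inv_sq_le k (N + 1))
          refine sum_nbij' (fun j => j + 1) (fun i => i - 1) ?_ ?_ ?_ ?_ ?_
          all_goals intro j hj
          all_goals simp only [mem_filter, Finset.mem_range, Finset.mem_Ioo] at hj ⊢
          all_goals first | omega | (push_cast; rfl)
        calc _ ≤ ((k : ℝ) + 1) * a k * (2 / ((k : ℝ) + 1)) :=
              mul_le_mul_of_nonneg_left h (mul_nonneg (by positivity) (ha k))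
          _ = 2 * a k := by field_simp
    _ ≤ 2 * B := by rw [← mul_sum]; linarith [hB N]

theorem summable_sum_Ico_div {a : ℕ → ℝ} {B : ℝ} (ha : ∀ k, 0 ≤ a k)
    (hB : ∀ N, ∑ k ∈ range N, a k ≤ B) (L : ℕ → ℕ) :
    Summable fun q : ℕ => ∑ k ∈ Ico (q + 1) (L q), a k / k := by
  have hak : ∀ k : ℕ, 0 ≤ a k / k := fun k => div_nonneg (ha k) (Nat.cast_nonneg k)
  refine summable_of_sum_range_le (c := B) (fun q => sum_nonneg fun k _ => hak k) fun N => ?_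
  set M := ∑ q ∈ range N, L q
  calc ∑ q ∈ range N, ∑ k ∈ Ico (q + 1) (L q), a k / k
      ≤ ∑ q ∈ range N, ∑ k ∈ range M, if q < k then a k / k else 0 := by
        refine sum_le_sum fun q hq => ?_
        rw [← sum_filter]
        refine sum_le_sum_of_subset_of_nonneg (fun k hk => ?_) fun k _ _ => hak k
        have hL : L q ≤ M := single_le_sum (f := L) (fun _ _ => Nat.zero_le _) hq
        simp only [mem_filter, Finset.mem_range, Finset.mem_Ico] at hk ⊢
        omega
    _ = ∑ k ∈ range M, ∑ q ∈ range N, if q < k then a k / k else 0 := sum_comm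
    _ ≤ ∑ k ∈ range M, a k := by
        refine sum_le_sum fun k _ => ?_
        rw [← sum_filter]
        calc _ ≤ ∑ q ∈ range k, a k / k := by
              refine sum_le_sum_of_subset_of_nonneg (fun q hq => ?_) fun _ _ _ => hak k
              exact Finset.mem_range.2 (mem_filter.1 hq).2
          _ ≤ a k := by
              rw [sum_const, card_range, nsmul_eq_mul]
              rcases eq_or_ne (k : ℝ) 0 with h | h
              · rw [h, zero_mul]; exact ha k
              · rw [mul_div_cancel₀ _ h]
    _ ≤ B := hB M

section Cesaro

variable {Ω : Type*} [MeasurableSpace Ω] {P : Measure Ω}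

theorem integral_sub_sq_le {h s : Ω → ℝ} (hh : MemLp h 2 P) (hs : MemLp s 2 P) :
    ∫ ω, (h ω - s ω) ^ 2 ∂P ≤ 2 * ∫ ω, h ω ^ 2 ∂P + 2 * ∫ ω, s ω ^ 2 ∂P := by
  rw [← integral_const_mul, ← integral_const_mul,
    ← integral_add (hh.integrable_sq.const_mul 2) (hs.integrable_sq.const_mul 2)]
  refine integral_mono (hh.sub hs).integrable_sq
    ((hh.integrable_sq.const_mul 2).add (hs.integrable_sq.const_mul 2)) fun ω => ?_
  nlinarith [sq_nonneg (h ω + s ω)]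

theorem memLp_mul_of_le_one {w h : Ω → ℝ} (hw : Measurable w) (hw0 : ∀ ω, 0 ≤ w ω)
    (hw1 : ∀ ω, w ω ≤ 1) (hh : MemLp h 2 P) : MemLp (fun ω => w ω * h ω) 2 P := by
  refine hh.of_le (hw.aestronglyMeasurable.mul hh.1) (.of_forall fun ω => ?_)
  rw [norm_mul, Real.norm_eq_abs, abs_of_nonneg (hw0 ω)]
  exact mul_le_of_le_one_left (norm_nonneg _) (hw1 ω)

theorem tendsto_cesaro_congr {u v : ℕ → ℝ} {l : ℝ} (huv : ∀ᶠ j in atTop, u j = v j)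
    (hu : Tendsto (fun J : ℕ => (∑ j ∈ range J, u j) / J) atTop (nhds l)) :
    Tendsto (fun J : ℕ => (∑ j ∈ range J, v j) / J) atTop (nhds l) := by
  have hd : Tendsto (fun j => v j - u j) atTop (nhds 0) :=
    tendsto_const_nhds.congr' (huv.mono fun j hj => (sub_eq_zero.2 hj.symm).symm)
  have := hu.add hd.cesaro
  rw [add_zero] at this
  refine this.congr fun J => ?_
  rw [sum_sub_distrib]
  ring

variable [IsProbabilityMeasure P]

theorem ae_tendsto_cesaro_trunc {g : ℕ → Ω → ℝ} (hg : ∀ n, Measurable (g n))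
    (h0 : ∀ n ω, 0 ≤ g n ω) {F : Ω → ℝ} (hF : MemLp F 2 P) {k : ℕ}
    (hcov : ∀ i I, i < I → k ≤ I →
      ∫ ω, (trunc (g i) k ω - F ω) * (trunc (g I) k ω - F ω) ∂P ≤ 1 / ((I : ℝ) + 1))
    {φ : ℕ → ℕ} (hφ : StrictMono φ) :
    ∀ᵐ ω ∂P, Tendsto (fun J : ℕ => (∑ j ∈ range J, trunc (g (φ j)) k ω) / J) atTop
      (nhds (F ω)) := by
  have hLp : ∀ j, MemLp (trunc (g (φ j)) k) 2 P := fun j => memLp_trunc (hg _) (h0 _) k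
  refine ae_tendsto_cesaro_of_almost_orthogonal (L := k) (s := fun _ => F)
    (v := fun _ => 2 * (k : ℝ) ^ 2 + 2 * ∫ ω, F ω ^ 2 ∂P) hLp (fun _ => hF)
    (fun j => trunc_nonneg (h0 _) k) ?_ ?_ ?_ ?_
  · intro l hl j hj
    refine (hcov _ _ (hφ hj) (hl.trans hφ.le_apply)).trans ?_
    have : (l : ℝ) ≤ φ l := Nat.cast_le.2 hφ.le_apply
    gcongr
  · intro j
    refine (integral_sub_sq_le (hLp j) hF).trans ?_
    gcongr
    calc ∫ ω, trunc (g (φ j)) k ω ^ 2 ∂P ≤ ∫ _, (k : ℝ) ^ 2 ∂P :=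
          integral_mono (hLp j).integrable_sq (integrable_const _) fun ω => by
            have := trunc_nonneg (h0 (φ j)) k ω
            have := trunc_le (g (φ j)) k ω
            dsimp only
            gcongr
      _ = (k : ℝ) ^ 2 := by simp
  · have := ((summable_nat_add_iff 1).2
      (Real.summable_one_div_nat_pow.2 (by norm_num : 1 < 2))).mul_left
        (2 * (k : ℝ) ^ 2 + 2 * ∫ ω, F ω ^ 2 ∂P)
    refine this.congr fun j => ?_
    push_cast
    ring
  · refine .of_forall fun ω => ?_
    refine tendsto_const_nhds.cesaro.congr fun J => ?_
    rw [div_eq_inv_mul]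

/-- `w` is a weight making the limit `∑ k, F (k + 1)` of the partial sums of the truncations
bounded; the conclusion concerns the set where it does not vanish. -/
theorem ae_tendsto_cesaro_of_weight {g F : ℕ → Ω → ℝ} (hg : ∀ n, Measurable (g n))
    (h0 : ∀ n ω, 0 ≤ g n ω) (hF0 : ∀ k ω, 0 ≤ F k ω)
    (hF : ∀ k, MemLp (F k) 2 P) {w : Ω → ℝ} (hw : Measurable w) (hw0 : ∀ ω, 0 ≤ w ω)
    (hw1 : ∀ ω, w ω ≤ 1) (hwF : ∀ q ω, w ω * ∑ k ∈ range q, F (k + 1) ω ≤ 1)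
    (hcov : ∀ i I, i < I → ∀ p ≤ I, ∀ q ≤ I,
      ∫ ω, (w ω * ∑ k ∈ range (p + 1), trunc (g i) (k + 1) ω -
          w ω * ∑ k ∈ range (p + 1), F (k + 1) ω) *
        (w ω * ∑ k ∈ range (q + 1), trunc (g I) (k + 1) ω -
          w ω * ∑ k ∈ range (q + 1), F (k + 1) ω) ∂P ≤ 1 / ((I : ℝ) + 1))
    (hvar : ∀ I, ∀ q ≤ I, ∫ ω, (w ω * ∑ k ∈ range (q + 1), trunc (g I) (k + 1) ω) ^ 2 ∂P ≤
      ∑ k ∈ range (q + 1), ((k : ℝ) + 1) * ∫ ω, w ω ^ 2 * F (k + 1) ω ∂P + 1)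
    {L : ℕ → ℕ}
    (htail : ∀ I, ∀ q ≤ I,
      ∫ ω, w ω ^ 2 * {ω | ((q + 1 : ℕ) : ℝ) ≤ g I ω}.indicator (fun _ => (1 : ℝ)) ω ∂P ≤
      ∑ k ∈ Ico (q + 1) (L q), (∫ ω, w ω ^ 2 * F (k + 1) ω ∂P) / k + (1 / 2) ^ q)
    {φ : ℕ → ℕ} (hφ : StrictMono φ) :
    ∀ᵐ ω ∂P, w ω ≠ 0 → Tendsto (fun J : ℕ => (∑ j ∈ range J, g (φ j) ω) / J) atTop
      (nhds (∑' k, F (k + 1) ω)) := by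
  have hT : ∀ n q, MemLp (fun ω => ∑ k ∈ range q, trunc (g n) (k + 1) ω) 2 P := fun n q =>
    memLp_finsetSum _ fun k _ => memLp_trunc (hg n) (h0 n) (k + 1)
  have hS : ∀ q, MemLp (fun ω => ∑ k ∈ range q, F (k + 1) ω) 2 P := fun q =>
    memLp_finsetSum _ fun k _ => hF (k + 1)
  have hwT : ∀ n q, MemLp (fun ω => w ω * ∑ k ∈ range q, trunc (g n) (k + 1) ω) 2 P :=
    fun n q => memLp_mul_of_le_one hw hw0 hw1 (hT n q)
  have hwS : ∀ q, MemLp (fun ω => w ω * ∑ k ∈ range q, F (k + 1) ω) 2 P :=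
    fun q => memLp_mul_of_le_one hw hw0 hw1 (hS q)
  have hwS0 : ∀ q ω, 0 ≤ w ω * ∑ k ∈ range q, F (k + 1) ω := fun q ω =>
    mul_nonneg (hw0 ω) (sum_nonneg fun k _ => hF0 _ ω)
  set a : ℕ → ℝ := fun k => ∫ ω, w ω ^ 2 * F (k + 1) ω ∂P with ha_def
  have ha : ∀ k, 0 ≤ a k := fun k =>
    integral_nonneg fun ω => mul_nonneg (sq_nonneg _) (hF0 _ ω)
  have haint : ∀ k, Integrable (fun ω => w ω ^ 2 * F (k + 1) ω) P := fun k =>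
    (memLp_mul_of_le_one (hw.pow_const 2) (fun ω => sq_nonneg _)
      (fun ω => pow_le_one₀ (hw0 ω) (hw1 ω)) (hF (k + 1))).integrable (by norm_num)
  have haB : ∀ N, ∑ k ∈ range N, a k ≤ 1 := by
    intro N
    rw [ha_def, ← integral_finsetSum _ fun k _ => haint k]
    calc _ ≤ ∫ _, (1 : ℝ) ∂P := by
          refine integral_mono (integrable_finsetSum _ fun k _ => haint k)
            (integrable_const _) fun ω => ?_
          dsimp only
          rw [← mul_sum, sq, mul_assoc]
          exact mul_le_one₀ (hw1 ω) (hwS0 N ω) (hwF N ω)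
      _ = 1 := by simp
  have hlim : ∀ ω, w ω ≠ 0 →
      Tendsto (fun q => ∑ k ∈ range q, F (k + 1) ω) atTop (nhds (∑' k, F (k + 1) ω)) := by
    intro ω hω
    refine (summable_of_sum_range_le (c := (w ω)⁻¹) (fun k => hF0 _ ω)
      fun q => ?_).hasSum.tendsto_sum_nat
    rw [← one_div, le_div_iff₀' ((hw0 ω).lt_of_ne' hω)]
    exact hwF q ω
  have hmain : ∀ᵐ ω ∂P, Tendsto (fun J : ℕ => (∑ j ∈ range J,
      w ω * ∑ k ∈ range (j + 1), trunc (g (φ j)) (k + 1) ω) / J) atTop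
      (nhds (w ω * ∑' k, F (k + 1) ω)) := by
    refine ae_tendsto_cesaro_of_almost_orthogonal (L := 0)
      (h := fun j ω => w ω * ∑ k ∈ range (j + 1), trunc (g (φ j)) (k + 1) ω)
      (s := fun j ω => w ω * ∑ k ∈ range (j + 1), F (k + 1) ω)
      (v := fun j => 2 * ∑ k ∈ range (j + 1), ((k : ℝ) + 1) * a k + 4)
      (fun j => hwT _ _) (fun j => hwS _)
      (fun j ω => mul_nonneg (hw0 ω) (sum_nonneg fun k _ => trunc_nonneg (h0 _) _ ω)) ?_ ?_ ?_ ?_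
    · intro l _ j hj
      refine (hcov _ _ (hφ hj) j (hj.le.trans hφ.le_apply) l hφ.le_apply).trans ?_
      have : (l : ℝ) ≤ φ l := Nat.cast_le.2 hφ.le_apply
      gcongr
    · intro j
      refine (integral_sub_sq_le (hwT _ _) (hwS _)).trans ?_
      have h1 : ∫ ω, (w ω * ∑ k ∈ range (j + 1), F (k + 1) ω) ^ 2 ∂P ≤ 1 :=
        calc _ ≤ ∫ _, (1 : ℝ) ∂P := integral_mono (hwS _).integrable_sq (integrable_const _)
              fun ω => pow_le_one₀ (hwS0 _ ω) (hwF _ ω)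
          _ = 1 := by simp
      linarith [hvar (φ j) j hφ.le_apply]
    · have h4 : Summable fun j : ℕ => 4 / ((j : ℝ) + 1) ^ 2 := by
        have := ((summable_nat_add_iff 1).2
          (Real.summable_one_div_nat_pow.2 (by norm_num : 1 < 2))).mul_left 4
        simpa [div_eq_mul_inv] using this
      refine (((summable_sum_mul_div_sq ha haB).mul_left 2).add h4).congr fun j => ?_
      ring
    · refine .of_forall fun ω => ?_
      have hlim' : Tendsto (fun j => w ω * ∑ k ∈ range (j + 1), F (k + 1) ω) atTop
          (nhds (w ω * ∑' k, F (k + 1) ω)) := by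
        by_cases hω : w ω = 0
        · simp [hω]
        · exact ((hlim ω hω).comp (tendsto_add_atTop_nat 1)).const_mul _
      exact hlim'.cesaro.congr fun J => by rw [div_eq_inv_mul]
  have hind : ∀ j, Measurable fun ω =>
      {ω | ((j + 1 : ℕ) : ℝ) ≤ g (φ j) ω}.indicator (fun _ => (1 : ℝ)) ω := fun j =>
    measurable_const.indicator (measurableSet_le measurable_const (hg _))
  have hind0 : ∀ j ω, 0 ≤ {ω | ((j + 1 : ℕ) : ℝ) ≤ g (φ j) ω}.indicator (fun _ => (1 : ℝ)) ω :=
    fun j ω => Set.indicator_nonneg (fun _ _ => zero_le_one) _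
  have hBC : ∀ᵐ ω ∂P, Tendsto (fun j => w ω ^ 2 *
      {ω | ((j + 1 : ℕ) : ℝ) ≤ g (φ j) ω}.indicator (fun _ => (1 : ℝ)) ω) atTop (nhds 0) := by
    refine ae_tendsto_zero_of_summable_integral (fun j => ?_)
      (fun j ω => mul_nonneg (sq_nonneg _) (hind0 j ω)) ?_
    · refine Integrable.of_bound ((hw.pow_const 2).mul (hind j)).aestronglyMeasurable 1
        (.of_forall fun ω => ?_)
      rw [Real.norm_eq_abs, abs_of_nonneg (mul_nonneg (sq_nonneg _) (hind0 j ω))]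
      exact mul_le_one₀ (pow_le_one₀ (hw0 ω) (hw1 ω)) (hind0 j ω)
        (Set.indicator_le' (fun _ _ => le_rfl) (fun _ _ => zero_le_one) ω)
    · exact Summable.of_nonneg_of_le
        (fun j => integral_nonneg fun ω => mul_nonneg (sq_nonneg _) (hind0 j ω))
        (fun j => htail (φ j) j hφ.le_apply)
        ((summable_sum_Ico_div ha haB L).add summable_geometric_two)
  filter_upwards [hmain, hBC] with ω hω hω' hwω
  have hdiv := hω.const_mul (w ω)⁻¹
  rw [inv_mul_cancel_left₀ hwω] at hdiv
  refine tendsto_cesaro_congr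
    (u := fun j => ∑ k ∈ range (j + 1), trunc (g (φ j)) (k + 1) ω) ?_
    (hdiv.congr fun J => by rw [← mul_sum]; field_simp)
  filter_upwards [hω'.eventually_lt_const (show 0 < w ω ^ 2 by positivity)] with j hj
  rw [sum_trunc (h0 _), if_pos]
  by_contra hge
  rw [Set.indicator_of_mem (show ω ∈ {ω | ((j + 1 : ℕ) : ℝ) ≤ g (φ j) ω} from not_lt.1 hge),
    mul_one] at hj
  exact lt_irrefl _ hj

theorem exists_subseq_tendsto_cesaro {g F : ℕ → Ω → ℝ} (hg : ∀ n, Measurable (g n))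
    (h0 : ∀ n ω, 0 ≤ g n ω) (hF0 : ∀ k ω, 0 ≤ F k ω) (hF : ∀ k, MemLp (F k) 2 P)
    (hweak : ∀ k Z, MemLp Z 2 P → Tendsto (fun N => ∫ ω, trunc (g N) k ω * Z ω ∂P) atTop
      (nhds (∫ ω, F k ω * Z ω ∂P)))
    {w : Ω → ℝ} (hw : Measurable w) (hw0 : ∀ ω, 0 ≤ w ω)
    (hw1 : ∀ ω, w ω ≤ 1) (hwF : ∀ q ω, w ω * ∑ k ∈ range q, F (k + 1) ω ≤ 1) :
    ∃ n : ℕ → ℕ, StrictMono n ∧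
      (∀ k, ∀ φ : ℕ → ℕ, StrictMono φ → ∀ᵐ ω ∂P, Tendsto
        (fun J : ℕ => (∑ j ∈ range J, trunc (g (n (φ j))) k ω) / J) atTop (nhds (F k ω))) ∧
      ((∀ ε > 0, ∃ L : ℕ, ∀ᶠ N in atTop, P.real {ω | (L : ℝ) ≤ g N ω ∧ w ω ≠ 0} ≤ ε) →
        ∀ φ : ℕ → ℕ, StrictMono φ → ∀ᵐ ω ∂P, w ω ≠ 0 → Tendsto
          (fun J : ℕ => (∑ j ∈ range J, g (n (φ j)) ω) / J) atTop
            (nhds (∑' k, F (k + 1) ω))) := by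
  have ht : ∀ n k, MemLp (trunc (g n) k) 2 P := fun n k => memLp_trunc (hg n) (h0 n) k
  have hw2 : ∀ ω, w ω ^ 2 ≤ 1 := fun ω => pow_le_one₀ (hw0 ω) (hw1 ω)
  have hw2L : MemLp (fun ω => w ω ^ 2) 2 P :=
    MemLp.of_bound (hw.pow_const 2).aestronglyMeasurable 1 (.of_forall fun ω => by
      rw [Real.norm_eq_abs, abs_of_nonneg (sq_nonneg _)]; exact hw2 ω)
  have hT : ∀ n q, MemLp (fun ω => ∑ k ∈ range q, trunc (g n) (k + 1) ω) 2 P := fun n q =>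
    memLp_finsetSum _ fun k _ => ht n (k + 1)
  have hS : ∀ q, MemLp (fun ω => ∑ k ∈ range q, F (k + 1) ω) 2 P := fun q =>
    memLp_finsetSum _ fun k _ => hF (k + 1)
  have hwT : ∀ n q, MemLp (fun ω => w ω * ∑ k ∈ range q, trunc (g n) (k + 1) ω) 2 P :=
    fun n q => memLp_mul_of_le_one hw hw0 hw1 (hT n q)
  have hwS : ∀ q, MemLp (fun ω => w ω * ∑ k ∈ range q, F (k + 1) ω) 2 P :=
    fun q => memLp_mul_of_le_one hw hw0 hw1 (hS q)
  have hdiff : ∀ k Z, MemLp Z 2 P →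
      Tendsto (fun N => ∫ ω, Z ω * (trunc (g N) k ω - F k ω) ∂P) atTop (nhds 0) := by
    intro k Z hZ
    have h := (hweak k Z hZ).sub_const (∫ ω, F k ω * Z ω ∂P)
    rw [sub_self] at h
    refine h.congr fun N => ?_
    have htZ : Integrable (fun ω => trunc (g N) k ω * Z ω) P := (ht N k).integrable_mul hZ
    have hFZ : Integrable (fun ω => F k ω * Z ω) P := (hF k).integrable_mul hZ
    rw [← integral_sub htZ hFZ]
    congr 1
    ext ω
    ring
  have hdiffsum : ∀ q Z, MemLp Z 2 P → Tendsto (fun N => ∫ ω, Z ω *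
      (w ω * ∑ k ∈ range q, trunc (g N) (k + 1) ω - w ω * ∑ k ∈ range q, F (k + 1) ω) ∂P)
      atTop (nhds 0) := by
    intro q Z hZ
    have hwZ := memLp_mul_of_le_one hw hw0 hw1 hZ
    have h := tendsto_finsetSum (range q) fun k _ => hdiff (k + 1) _ hwZ
    rw [sum_const_zero] at h
    refine h.congr fun N => ?_
    have hint : ∀ k, Integrable
        (fun ω => w ω * Z ω * (trunc (g N) (k + 1) ω - F (k + 1) ω)) P := fun k =>
      hwZ.integrable_mul ((ht N (k + 1)).sub (hF (k + 1)))
    rw [← integral_finsetSum _ fun k _ => hint k]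
    congr 1
    ext ω
    rw [← mul_sum, sum_sub_distrib]
    ring
  have hsq : ∀ k, Tendsto (fun N => ∫ ω, w ω ^ 2 * trunc (g N) k ω ∂P) atTop
      (nhds (∫ ω, w ω ^ 2 * F k ω ∂P)) := by
    intro k
    simpa only [mul_comm] using hweak k _ hw2L
  have hsqint : ∀ N k, Integrable (fun ω => w ω ^ 2 * trunc (g N) k ω) P := fun N k =>
    hw2L.integrable_mul (ht N k)
  have hvar : ∀ q, ∀ᶠ N in atTop,
      ∫ ω, (w ω * ∑ k ∈ range (q + 1), trunc (g N) (k + 1) ω) ^ 2 ∂P ≤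
        ∑ k ∈ range (q + 1), ((k : ℝ) + 1) * ∫ ω, w ω ^ 2 * F (k + 1) ω ∂P + 1 := by
    intro q
    have h := tendsto_finsetSum (range (q + 1)) fun k _ =>
      (hsq (k + 1)).const_mul ((k : ℝ) + 1)
    filter_upwards [h.eventually_le_const (lt_add_one _)] with N hN
    refine le_trans ?_ hN
    simp_rw [← integral_const_mul]
    rw [← integral_finsetSum _ fun k _ => (hsqint N (k + 1)).const_mul _]
    refine integral_mono (hwT N _).integrable_sq
      (integrable_finsetSum _ fun k _ => (hsqint N (k + 1)).const_mul _) fun ω => ?_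
    calc _ = w ω ^ 2 * (∑ k ∈ range (q + 1), trunc (g N) (k + 1) ω) ^ 2 := mul_pow _ _ _
      _ ≤ w ω ^ 2 * ∑ k ∈ range (q + 1), ((k : ℝ) + 1) * trunc (g N) (k + 1) ω := by
          gcongr
          exact sq_sum_trunc_le (h0 N) _ ω
      _ = _ := by rw [mul_sum]; exact sum_congr rfl fun k _ => by ring
  have htail : ∃ L : ℕ → ℕ,
      (∀ ε > 0, ∃ L : ℕ, ∀ᶠ N in atTop, P.real {ω | (L : ℝ) ≤ g N ω ∧ w ω ≠ 0} ≤ ε) →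
      ∀ q, ∀ᶠ N in atTop,
        ∫ ω, w ω ^ 2 * {ω | ((q + 1 : ℕ) : ℝ) ≤ g N ω}.indicator (fun _ => (1 : ℝ)) ω ∂P ≤
        ∑ k ∈ Ico (q + 1) (L q), (∫ ω, w ω ^ 2 * F (k + 1) ω ∂P) / k + (1 / 2) ^ q := by
    by_cases htight :
      ∀ ε > 0, ∃ L : ℕ, ∀ᶠ N in atTop, P.real {ω | (L : ℝ) ≤ g N ω ∧ w ω ≠ 0} ≤ ε
    swap
    · exact ⟨id, fun h => absurd h htight⟩
    choose L hL using fun q : ℕ => htight ((1 / 2) ^ q / 2) (by positivity)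
    refine ⟨L, fun _ q => ?_⟩
    have h := tendsto_finsetSum (Ico (q + 1) (L q)) fun k _ => (hsq (k + 1)).div_const (k : ℝ)
    filter_upwards [hL q, h.eventually_le_const (lt_add_of_pos_right _
      (show (0 : ℝ) < (1 / 2) ^ q / 2 by positivity))] with N hN1 hN2
    set A := {ω | (L q : ℝ) ≤ g N ω ∧ w ω ≠ 0}
    have hA : MeasurableSet A := (measurableSet_le measurable_const (hg N)).inter
      (hw (measurableSet_singleton 0).compl)
    have hsumint : Integrable (fun ω => ∑ k ∈ Ico (q + 1) (L q),
        w ω ^ 2 * trunc (g N) (k + 1) ω / k) P :=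
      integrable_finsetSum _ fun k _ => (hsqint N (k + 1)).div_const _
    have hAint : Integrable (A.indicator fun _ => (1 : ℝ)) P := (integrable_const _).indicator hA
    calc _ ≤ ∫ ω, (∑ k ∈ Ico (q + 1) (L q), w ω ^ 2 * trunc (g N) (k + 1) ω / k +
          A.indicator (fun _ => (1 : ℝ)) ω) ∂P := by
          refine integral_mono_of_nonneg (.of_forall fun ω => mul_nonneg (sq_nonneg _)
            (Set.indicator_nonneg (fun _ _ => zero_le_one) _)) (hsumint.add hAint)
            (.of_forall fun ω => ?_)
          refine (mul_le_mul_of_nonneg_left (indicator_le_sum_trunc (h0 N) (L := L q)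
            (Nat.le_add_left 1 q) ω) (sq_nonneg (w ω))).trans ?_
          rw [mul_add, mul_sum]
          simp only [mul_div_assoc]
          gcongr
          by_cases hω : ω ∈ A
          · rw [Set.indicator_of_mem hω, Set.indicator_of_mem
              (show ω ∈ {ω | (L q : ℝ) ≤ g N ω} from hω.1), mul_one]
            exact hw2 ω
          · rw [Set.indicator_of_notMem hω]
            by_cases hwω : w ω = 0
            · simp [hwω]
            · rw [Set.indicator_of_notMem
                (show ω ∉ {ω | (L q : ℝ) ≤ g N ω} from fun h => hω ⟨h, hwω⟩), mul_zero]
      _ = ∑ k ∈ Ico (q + 1) (L q), (∫ ω, w ω ^ 2 * trunc (g N) (k + 1) ω ∂P) / k +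
          P.real A := by
          rw [integral_add hsumint hAint, integral_finsetSum _ fun k _ =>
            (hsqint N (k + 1)).div_const _, integral_indicator_const _ hA]
          simp [integral_div]
      _ ≤ _ := by linarith
  obtain ⟨L, hL⟩ := htail
  have hpos : ∀ I : ℕ, (0 : ℝ) < 1 / ((I : ℝ) + 1) := fun I => by positivity
  obtain ⟨n, hn, hR, hQ⟩ := exists_strictMono_forall_lt
    (R := fun I N => (∀ q ∈ Set.Iic I,
      ∫ ω, (w ω * ∑ k ∈ range (q + 1), trunc (g N) (k + 1) ω) ^ 2 ∂P ≤
        ∑ k ∈ range (q + 1), ((k : ℝ) + 1) * ∫ ω, w ω ^ 2 * F (k + 1) ω ∂P + 1) ∧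
      ((∀ ε > 0, ∃ L : ℕ, ∀ᶠ N in atTop, P.real {ω | (L : ℝ) ≤ g N ω ∧ w ω ≠ 0} ≤ ε) →
        ∀ q ∈ Set.Iic I,
        ∫ ω, w ω ^ 2 * {ω | ((q + 1 : ℕ) : ℝ) ≤ g N ω}.indicator (fun _ => (1 : ℝ)) ω ∂P ≤
        ∑ k ∈ Ico (q + 1) (L q), (∫ ω, w ω ^ 2 * F (k + 1) ω ∂P) / k + (1 / 2) ^ q))
    (Q := fun I m N => (∀ k ∈ Set.Iic I,
      ∫ ω, (trunc (g m) k ω - F k ω) * (trunc (g N) k ω - F k ω) ∂P ≤ 1 / ((I : ℝ) + 1)) ∧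
      ∀ p ∈ Set.Iic I, ∀ q ∈ Set.Iic I,
      ∫ ω, (w ω * ∑ k ∈ range (p + 1), trunc (g m) (k + 1) ω -
          w ω * ∑ k ∈ range (p + 1), F (k + 1) ω) *
        (w ω * ∑ k ∈ range (q + 1), trunc (g N) (k + 1) ω -
          w ω * ∑ k ∈ range (q + 1), F (k + 1) ω) ∂P ≤ 1 / ((I : ℝ) + 1))
    (fun I => by
      refine ((eventually_all_finite (Set.finite_Iic I)).2 fun q _ => hvar q).and ?_
      by_cases htight :
        ∀ ε > 0, ∃ L : ℕ, ∀ᶠ N in atTop, P.real {ω | (L : ℝ) ≤ g N ω ∧ w ω ≠ 0} ≤ ε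
      · exact ((eventually_all_finite (Set.finite_Iic I)).2 fun q _ => hL htight q).mono
          fun N hN _ => hN
      · exact .of_forall fun N h => absurd h htight)
    (fun I m => by
      refine ((eventually_all_finite (Set.finite_Iic I)).2 fun k _ => ?_).and
        ((eventually_all_finite (Set.finite_Iic I)).2 fun p _ =>
          (eventually_all_finite (Set.finite_Iic I)).2 fun q _ => ?_)
      · exact (hdiff k _ ((ht m k).sub (hF k))).eventually_le_const (hpos I)
      · exact (hdiffsum (q + 1) _ ((hwT m (p + 1)).sub (hwS (p + 1)))).eventually_le_const (hpos I))
  refine ⟨n, hn, fun k φ hφ => ?_, fun htight φ hφ => ?_⟩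
  · exact ae_tendsto_cesaro_trunc (g := fun j => g (n j)) (fun j => hg _) (fun j => h0 _) (hF k)
      (fun i I hi hk => (hQ i I hi).1 k hk) hφ
  · exact ae_tendsto_cesaro_of_weight (g := fun j => g (n j)) (fun j => hg _) (fun j => h0 _) hF0
      hF hw hw0 hw1 hwF (fun i I hi p hp q hq => (hQ i I hi).2 p hp q hq)
      (fun I q hq => (hR I).1 q hq) (fun I q hq => (hR I).2 htight q hq) hφ

end Cesaro

theorem tendsto_ofReal_cesaro_top {u : ℕ → ℝ} {t : ℕ → ℕ → ℝ} {F : ℕ → ℝ} (hF : ∀ k, 0 ≤ F k)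
    (htu : ∀ q j, ∑ k ∈ range q, t k j ≤ u j)
    (ht : ∀ k, Tendsto (fun J : ℕ => (∑ j ∈ range J, t k j) / J) atTop (nhds (F k)))
    (htop : ∑' k, ENNReal.ofReal (F k) = ⊤) :
    Tendsto (fun J : ℕ => ENNReal.ofReal ((∑ j ∈ range J, u j) / J)) atTop (nhds ⊤) := by
  rw [ENNReal.tendsto_nhds_top_iff_nat]
  intro m
  have hsum := ENNReal.tendsto_nat_tsum fun k => ENNReal.ofReal (F k)
  rw [htop, ENNReal.tendsto_nhds_top_iff_nat] at hsum
  obtain ⟨q, hq⟩ := (hsum m).exists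
  rw [← ENNReal.ofReal_sum_of_nonneg fun k _ => hF k, ← ENNReal.ofReal_natCast,
    ENNReal.ofReal_lt_ofReal_iff_of_nonneg (Nat.cast_nonneg m)] at hq
  filter_upwards [(tendsto_finsetSum (range q) fun k _ => ht k).eventually_const_lt hq] with J hJ
  rw [← ENNReal.ofReal_natCast, ENNReal.ofReal_lt_ofReal_iff_of_nonneg (Nat.cast_nonneg m)]
  refine hJ.trans_le ?_
  rw [← sum_div, sum_comm]
  gcongr with j
  exact htu q j

/-- For any sequence of nonnegative measurable functions there exist a subsequence and
limits `f^(k)` of the truncations in the hereditary Cesàro sense such that, with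
`f = ∑_k f^(k)`, the following holds: if
`lim_{K→∞} limsup_{j→∞} P(f_{n_j} ≥ K, f < ∞) = 0`, then the subsequence converges
hereditarily in Cesàro mean to `f`, `P`-a.e. -/
theorem hereditary_cesaro_of_tight {Ω : Type*} [MeasurableSpace Ω] (P : Measure Ω)
    [IsProbabilityMeasure P] (f : ℕ → Ω → ℝ)
    (hmeas : ∀ n, Measurable (f n)) (hpos : ∀ n ω, 0 ≤ f n ω) :
    ∃ n : ℕ → ℕ, StrictMono n ∧
      ∃ F : ℕ → Ω → ℝ,
        (∀ k, Measurable (F k)) ∧ (∀ k ω, 0 ≤ F k ω) ∧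
        (∀ k : ℕ, 1 ≤ k → ∀ φ : ℕ → ℕ, StrictMono φ →
          ∀ᵐ ω ∂P, Tendsto
            (fun J : ℕ => (∑ j ∈ Finset.range J, trunc (f (n (φ j))) k ω) / J)
            atTop (nhds (F k ω))) ∧
        (Tendsto
            (fun K : ℕ =>
              Filter.limsup
                (fun j : ℕ =>
                  P {ω | (K : ℝ) ≤ f (n j) ω ∧
                      (∑' k : ℕ, ENNReal.ofReal (F (k + 1) ω)) ≠ ⊤})
                atTop)
            atTop (nhds 0) →
          ∀ φ : ℕ → ℕ, StrictMono φ →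
            ∀ᵐ ω ∂P, Tendsto
              (fun J : ℕ =>
                ENNReal.ofReal ((∑ j ∈ Finset.range J, f (n (φ j)) ω) / J))
              atTop (nhds (∑' k : ℕ, ENNReal.ofReal (F (k + 1) ω)))) := by
  obtain ⟨φ₀, hφ₀, F, hFm, hF0, hF, hweak⟩ := exists_subseq_weak_limit P
    (fun k n => trunc (f n) k) (fun k => (k : ℝ)) (fun k n => measurable_trunc (hmeas n) k)
    (fun k n => trunc_nonneg (hpos n) k) (fun k n => trunc_le (f n) k)
  set S : Ω → ℝ≥0∞ := fun ω => ∑' k, ENNReal.ofReal (F (k + 1) ω)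
  have hS : Measurable S := Measurable.tsum fun k => (hFm (k + 1)).ennreal_ofReal
  set w : Ω → ℝ := fun ω => ((1 + S ω)⁻¹).toReal
  have hw : Measurable w := (measurable_const.add hS).inv.ennreal_toReal
  have hw1 : ∀ ω, w ω ≤ 1 := fun ω =>
    ENNReal.toReal_le_of_le_ofReal zero_le_one (by simp)
  have hwS : ∀ ω, w ω ≠ 0 ↔ S ω ≠ ⊤ := by
    intro ω
    simp [w, ENNReal.toReal_eq_zero_iff]
  have hwF : ∀ q ω, w ω * ∑ k ∈ range q, F (k + 1) ω ≤ 1 := by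
    intro q ω
    have hle : ENNReal.ofReal (∑ k ∈ range q, F (k + 1) ω) ≤ 1 + S ω := by
      rw [ENNReal.ofReal_sum_of_nonneg fun k _ => hF0 _ ω]
      exact (ENNReal.sum_le_tsum _).trans le_add_self
    rw [← ENNReal.toReal_ofReal (sum_nonneg fun k _ => hF0 (k + 1) ω), ← ENNReal.toReal_mul]
    refine ENNReal.toReal_le_of_le_ofReal zero_le_one ?_
    rw [ENNReal.ofReal_one]
    exact (mul_le_mul_right hle _).trans (ENNReal.inv_mul_le_one _)
  let Tight : (ℕ → ℕ) → Prop := fun ψ => ∀ ε > 0, ∃ L : ℕ, ∀ᶠ N in atTop,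
    P.real {ω | (L : ℝ) ≤ f (ψ N) ω ∧ w ω ≠ 0} ≤ ε
  obtain ⟨ψ, hψ, hψT⟩ : ∃ ψ : ℕ → ℕ, StrictMono ψ ∧
      ∀ χ : ℕ → ℕ, StrictMono χ → Tight (φ₀ ∘ ψ ∘ χ) → Tight (φ₀ ∘ ψ) := by
    by_cases h : ∃ ψ : ℕ → ℕ, StrictMono ψ ∧ Tight (φ₀ ∘ ψ)
    · obtain ⟨ψ, hψ, hT⟩ := h
      exact ⟨ψ, hψ, fun _ _ _ => hT⟩
    · exact ⟨id, strictMono_id, fun χ hχ hT => absurd ⟨χ, hχ, hT⟩ h⟩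
  obtain ⟨n, hn, htrunc, hconv⟩ := exists_subseq_tendsto_cesaro (P := P)
    (g := fun j => f (φ₀ (ψ j))) (fun j => hmeas _) (fun j => hpos _) hF0 hF
    (fun k Z hZ => (hweak k Z hZ).comp hψ.tendsto_atTop) hw
    (fun ω => ENNReal.toReal_nonneg) hw1 hwF
  refine ⟨fun j => φ₀ (ψ (n j)), hφ₀.comp (hψ.comp hn), F, hFm, hF0,
    fun k _ φ hφ => htrunc k φ hφ, fun hlim φ hφ => ?_⟩
  have hT : Tight (φ₀ ∘ ψ) := by
    refine hψT n hn fun ε hε => ?_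
    obtain ⟨K, hK⟩ := (hlim.eventually_lt_const (ENNReal.ofReal_pos.2 hε)).exists
    refine ⟨K, (eventually_lt_of_limsup_lt hK).mono fun j hj => ?_⟩
    refine ENNReal.toReal_le_of_le_ofReal hε.le (le_trans (le_of_eq ?_) hj.le)
    simp only [hwS]
    rfl
  filter_upwards [hconv hT φ hφ, ae_all_iff.2 fun k => htrunc (k + 1) φ hφ] with ω hω hωt
  by_cases htop : S ω = ⊤
  · change Tendsto _ _ (nhds (S ω))
    rw [htop]
    refine tendsto_ofReal_cesaro_top (fun k => hF0 (k + 1) ω) (fun q j => ?_) hωt htop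
    rw [sum_trunc (hpos _)]
    split_ifs
    exacts [le_rfl, hpos _ _]
  · have hsum : Summable fun k => F (k + 1) ω := by
      have := ENNReal.summable_toReal htop
      simpa only [ENNReal.toReal_ofReal (hF0 _ ω)] using this
    rw [← ENNReal.ofReal_tsum_of_nonneg (fun k => hF0 (k + 1) ω) hsum]
    exact ENNReal.tendsto_ofReal (hω ((hwS ω).2 htop))
end

section
/- Let {f_n} be a sequence of nonnegative measurable functions on a probability space (Ω, F, P) such that for every k ∈ ℕ the truncations f_n^{(k)} := f_n · 1_{{k−1 ≤ f_n < k}} converge hereditarily in Cesàro mean, P-a.e., to a measurable function f^{(k)} : Ω → [0, ∞), and set f := Σ_{k∈ℕ} f^{(k)}. Let D ⊆ {f < ∞} be a measurable set with E(f · 1_D) < ∞, and let ε ∈ (0,1). Then there exists K ∈ ℕ such that for every integer L > K, the inequality E[ f_n · 1_{{K ≤ f_n < L} ∩ D} ] < ε holds for all but finitely many n ∈ ℕ. -/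
open MeasureTheory Filter Finset
open scoped ENNReal

/-- The consecutive truncations at levels `K + 1, …, L` add up to `g · 1_{K ≤ g < L}`. -/
lemma sum_Ico_trunc {Ω : Type*} (g : Ω → ℝ) {K L : ℕ} (h : K ≤ L) (ω : Ω) :
    ∑ k ∈ Finset.Ico K L, trunc g (k + 1) ω =
      ({ω | (K : ℝ) ≤ g ω ∧ g ω < L}).indicator g ω := by
  induction L, h using Nat.le_induction with
  | base =>
    have : ¬ ((K : ℝ) ≤ g ω ∧ g ω < K) := fun h => absurd h.1 (not_le.2 h.2)
    simp [Set.indicator, this]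
  | succ L hL ih =>
    rw [Finset.sum_Ico_succ_top hL, ih]
    have hKL : (K : ℝ) ≤ L := by exact_mod_cast hL
    simp only [trunc, Set.indicator, Set.mem_ofPred_eq, Nat.cast_add, Nat.cast_one,
      add_sub_cancel_right]
    rcases lt_or_ge (g ω) L with h1 | h1
    · have h2 : g ω < L + 1 := by linarith
      simp [h1, h2, not_le.2 h1]
    · have h2 : (K : ℝ) ≤ g ω := hKL.trans h1
      simp [h1, h2, not_lt.2 h1]

/-- If the sum of a series of nonnegative functions `G k` has finite integral,
then the integrals of the blocks `∑_{K ≤ k < L} G k` are uniformly small for large `K`. -/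
lemma exists_integral_sum_Ico_lt {Ω : Type*} [MeasurableSpace Ω] (μ : Measure Ω)
    (G : ℕ → Ω → ℝ) (hGmeas : ∀ k, Measurable (G k)) (hGpos : ∀ k ω, 0 ≤ G k ω)
    (hint : ∫⁻ ω, (∑' k : ℕ, ENNReal.ofReal (G k ω)) ∂μ ≠ ⊤) {ε : ℝ} (hε : 0 < ε) :
    ∃ K : ℕ, ∀ L : ℕ, ∫ ω, ∑ k ∈ Finset.Ico K L, G k ω ∂μ < ε := by
  rw [lintegral_tsum fun k => (hGmeas k).ennreal_ofReal.aemeasurable] at hint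
  obtain ⟨K, hK⟩ := ((ENNReal.tendsto_sum_nat_add _ hint).eventually_lt_const
    (ENNReal.ofReal_pos.2 hε)).exists
  refine ⟨K, fun L => ?_⟩
  rw [integral_eq_lintegral_of_nonneg_ae
    (ae_of_all _ fun ω => Finset.sum_nonneg fun k _ => hGpos k ω)
    (Finset.measurable_fun_sum _ fun k _ => hGmeas k).aestronglyMeasurable]
  refine (ENNReal.lt_ofReal_iff_toReal_lt ?_).1 ?_ <;>
    simp_rw [ENNReal.ofReal_sum_of_nonneg fun k _ => hGpos k _] <;>
    rw [lintegral_finsetSum _ fun k _ => (hGmeas k).ennreal_ofReal]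
  · exact ((ENNReal.sum_le_tsum _).trans_lt hint.lt_top).ne
  · refine lt_of_le_of_lt ?_ hK
    rw [Finset.sum_Ico_eq_sum_range]
    simp_rw [add_comm K]
    exact ENNReal.sum_le_tsum (f := fun j => ∫⁻ ω, ENNReal.ofReal (G (j + K) ω) ∂μ) _

/-- Cesàro averages of uniformly bounded functions that converge almost everywhere cannot have all
integrals of the terms at least `ε` when the limit has integral below `ε`. -/
lemma le_integral_of_tendsto_cesaro {Ω : Type*} [MeasurableSpace Ω] (μ : Measure Ω)
    [IsFiniteMeasure μ] (g : ℕ → Ω → ℝ) (hgmeas : ∀ n, Measurable (g n)) {C ε : ℝ}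
    (hgC : ∀ n ω, ‖g n ω‖ ≤ C) (G : Ω → ℝ)
    (hG : ∀ᵐ ω ∂μ, Tendsto (fun J : ℕ => (∑ j ∈ Finset.range J, g j ω) / J)
      atTop (nhds (G ω)))
    (hε : ∀ n, ε ≤ ∫ ω, g n ω ∂μ) : ε ≤ ∫ ω, G ω ∂μ := by
  have hgi : ∀ n, Integrable (g n) μ := fun n =>
    Integrable.of_bound (hgmeas n).aestronglyMeasurable C (ae_of_all _ (hgC n))
  have hlim := tendsto_integral_of_dominated_convergence (μ := μ) (fun _ => C)
    (F := fun (J : ℕ) ω => (∑ j ∈ Finset.range (J + 1), g j ω) / ((J + 1 : ℕ) : ℝ))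
    (fun J => ((Finset.measurable_fun_sum _ fun j _ => hgmeas j).div_const
      _).aestronglyMeasurable)
    (integrable_const C)
    (fun J => ae_of_all _ fun ω => by
      have hJ : (0 : ℝ) < ((J + 1 : ℕ) : ℝ) := by positivity
      rw [norm_div, Real.norm_of_nonneg hJ.le, div_le_iff₀ hJ]
      refine (norm_sum_le_of_le _ fun j _ => hgC j ω).trans ?_
      simp [mul_comm])
    (hG.mono fun ω h => (tendsto_add_atTop_iff_nat 1).2 h)
  refine ge_of_tendsto' hlim fun J => ?_
  have hJ : (0 : ℝ) < ((J + 1 : ℕ) : ℝ) := by positivity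
  rw [integral_div, integral_finsetSum _ fun j _ => hgi j, le_div_iff₀ hJ]
  refine le_trans ?_ (Finset.card_nsmul_le_sum _ _ ε fun j _ => hε j)
  simp [mul_comm]

/-- Suppose the truncations `f_n^(k)` converge hereditarily in Cesàro mean to `F k`, set
`f = ∑_k F k`, and let `D ⊆ {f < ∞}` satisfy `E(f·1_D) < ∞`. Then for any `ε ∈ (0,1)`
there is `K ∈ ℕ` such that for every `L > K` the inequality
`E[f_n · 1_{{K ≤ f_n < L} ∩ D}] < ε` holds for all but finitely many `n`. -/
theorem truncated_expectation_eventually_small {Ω : Type*} [MeasurableSpace Ω]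
    (P : Measure Ω) [IsProbabilityMeasure P] (f : ℕ → Ω → ℝ)
    (hmeas : ∀ n, Measurable (f n)) (hpos : ∀ n ω, 0 ≤ f n ω)
    (F : ℕ → Ω → ℝ) (hFmeas : ∀ k, Measurable (F k)) (hFpos : ∀ k ω, 0 ≤ F k ω)
    (hF : ∀ k : ℕ, 1 ≤ k → ∀ φ : ℕ → ℕ, StrictMono φ →
      ∀ᵐ ω ∂P, Tendsto
        (fun J : ℕ => (∑ j ∈ Finset.range J, trunc (f (φ j)) k ω) / J)
        atTop (nhds (F k ω)))
    (D : Set Ω) (hD : MeasurableSet D)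
    (hDfin : D ⊆ {ω | (∑' k : ℕ, ENNReal.ofReal (F (k + 1) ω)) ≠ ⊤})
    (hint : ∫⁻ ω in D, (∑' k : ℕ, ENNReal.ofReal (F (k + 1) ω)) ∂P < ⊤)
    (ε : ℝ) (hε : ε ∈ Set.Ioo (0 : ℝ) 1) :
    ∃ K : ℕ, ∀ L : ℕ, K < L →
      ∀ᶠ n in atTop,
        ∫ ω in ({ω | (K : ℝ) ≤ f n ω ∧ f n ω < L} ∩ D), f n ω ∂P < ε := by
  obtain ⟨K, hK⟩ := exists_integral_sum_Ico_lt (P.restrict D) (fun k => F (k + 1))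
    (fun k => hFmeas _) (fun k => hFpos _) hint.ne hε.1
  refine ⟨K, fun L hL => ?_⟩
  by_contra hcon
  obtain ⟨φ, hφ, hφε⟩ := extraction_of_frequently_atTop (not_eventually.1 hcon)
  have hS : ∀ n, MeasurableSet {ω | (K : ℝ) ≤ f n ω ∧ f n ω < L} := fun n =>
    (measurableSet_le measurable_const (hmeas n)).inter
      (measurableSet_lt (hmeas n) measurable_const)
  refine (hK L).not_ge (le_integral_of_tendsto_cesaro (P.restrict D)
    (fun n => ({ω | (K : ℝ) ≤ f (φ n) ω ∧ f (φ n) ω < L}).indicator (f (φ n)))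
    (fun n => (hmeas _).indicator (hS _)) (C := L) (fun n ω => ?_) _ ?_ fun n => ?_)
  · by_cases h : ω ∈ {ω | (K : ℝ) ≤ f (φ n) ω ∧ f (φ n) ω < L}
    · rw [Set.indicator_of_mem h, Real.norm_of_nonneg (hpos _ _)]
      exact h.2.le
    · rw [Set.indicator_of_notMem h]
      simp
  · have hae : ∀ᵐ ω ∂(P.restrict D), ∀ k : ℕ, Tendsto
        (fun J : ℕ => (∑ j ∈ Finset.range J, trunc (f (φ j)) (k + 1) ω) / J)
        atTop (nhds (F (k + 1) ω)) :=
      ae_all_iff.2 fun k => ae_restrict_of_ae (hF (k + 1) (by omega) φ hφ)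
    filter_upwards [hae] with ω hω
    refine (tendsto_finsetSum (Finset.Ico K L) fun k _ => hω k).congr fun J => ?_
    rw [← Finset.sum_div, Finset.sum_comm]
    simp_rw [sum_Ico_trunc _ hL.le]
  · rw [integral_indicator (hS _), Measure.restrict_restrict (hS _)]
    exact not_lt.1 (hφε n)
end

section
/- Let {f_n} be a sequence of nonnegative measurable functions on a probability space (Ω, F, P) such that for every k ∈ ℕ the truncations f_n^{(k)} := f_n · 1_{{k−1 ≤ f_n < k}} converge hereditarily in Cesàro mean, P-a.e., to a measurable function f^{(k)} : Ω → [0, ∞), and set f := Σ_{k∈ℕ} f^{(k)} (with values in [0, ∞]). Then for every strictly increasing sequence of indices {m_j}: (a) liminf_{J→∞} (1/J) Σ_{j=1}^J f_{m_j} ≥ f holds P-a.e.; and (b) in particular, (1/J) Σ_{j=1}^J f_{m_j} → ∞ holds P-a.e. on the set A_∞ := {f = ∞}. -/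
open MeasureTheory Filter Finset
open scoped ENNReal

/-- The truncations of a nonnegative value at distinct levels have total at most that value. -/
theorem sum_trunc_le {Ω : Type*} (g : Ω → ℝ) (ω : Ω) (hg : 0 ≤ g ω) (K : ℕ) :
    ∑ k ∈ Finset.range K, trunc g (k + 1) ω ≤ g ω := by
  have h_trunc : ∀ k : ℕ, trunc g (k + 1) ω = if k = ⌊g ω⌋₊ then g ω else 0 := by
    intro k
    simp only [trunc, Set.indicator_apply, Set.mem_ofPred_eq, eq_comm (a := k),
      Nat.floor_eq_iff hg]
    push_cast
    simp
  simp only [h_trunc, Finset.sum_ite_eq']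
  split_ifs
  · exact le_rfl
  · exact hg

/-- If the Cesàro means of each truncation of a nonnegative sequence converge, then the lower
limit of its Cesàro means is at least the sum of the limits. -/
theorem tsum_le_liminf_cesaro {Ω : Type*} (g : ℕ → Ω → ℝ) (ω : Ω) (hg : ∀ j, 0 ≤ g j ω)
    (L : ℕ → ℝ) (hL : ∀ k, 0 ≤ L k)
    (h : ∀ k : ℕ, Tendsto
      (fun J : ℕ => (∑ j ∈ Finset.range J, trunc (g j) (k + 1) ω) / J) atTop (nhds (L k))) :
    ∑' k : ℕ, ENNReal.ofReal (L k) ≤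
      liminf (fun J : ℕ => ENNReal.ofReal ((∑ j ∈ Finset.range J, g j ω) / J)) atTop := by
  rw [ENNReal.tsum_eq_iSup_nat]
  refine iSup_le fun K => ?_
  rw [← ENNReal.ofReal_sum_of_nonneg fun k _ => hL k]
  have h_lim := ENNReal.tendsto_ofReal (tendsto_finsetSum (Finset.range K) fun k _ => h k)
  rw [← h_lim.liminf_eq]
  refine liminf_le_liminf (Eventually.of_forall fun J => ENNReal.ofReal_le_ofReal ?_)
  rw [← Finset.sum_div, Finset.sum_comm]
  gcongr with j
  exact sum_trunc_le (g j) ω (hg j) K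

/-- A real sequence whose positive part has infinite lower limit tends to infinity. -/
theorem tendsto_atTop_of_liminf_ofReal_eq_top {u : ℕ → ℝ}
    (h : liminf (fun n => ENNReal.ofReal (u n)) atTop = ⊤) : Tendsto u atTop atTop := by
  refine tendsto_atTop.2 fun C => ?_
  have hC : ENNReal.ofReal C < liminf (fun n => ENNReal.ofReal (u n)) atTop :=
    h ▸ ENNReal.ofReal_lt_top
  filter_upwards [eventually_lt_of_lt_liminf hC] with n hn
  exact (ENNReal.ofReal_lt_ofReal_iff'.1 hn).1.le

/-- Suppose the truncations `f_n^(k)` converge hereditarily in Cesàro mean to `F k` and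
set `f = ∑_k F k` (with values in `[0,∞]`). Then, along every subsequence:
(a) `liminf_J (1/J) ∑_{j≤J} f_{m_j} ≥ f` holds `P`-a.e.; and (b) the Cesàro averages
tend to `∞`, `P`-a.e. on the set `{f = ∞}`. -/
theorem cesaro_liminf_ge {Ω : Type*} [MeasurableSpace Ω] (P : Measure Ω)
    [IsProbabilityMeasure P] (f : ℕ → Ω → ℝ)
    (hmeas : ∀ n, Measurable (f n)) (hpos : ∀ n ω, 0 ≤ f n ω)
    (F : ℕ → Ω → ℝ) (hFmeas : ∀ k, Measurable (F k)) (hFpos : ∀ k ω, 0 ≤ F k ω)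
    (hF : ∀ k : ℕ, 1 ≤ k → ∀ φ : ℕ → ℕ, StrictMono φ →
      ∀ᵐ ω ∂P, Tendsto
        (fun J : ℕ => (∑ j ∈ Finset.range J, trunc (f (φ j)) k ω) / J)
        atTop (nhds (F k ω))) :
    ∀ φ : ℕ → ℕ, StrictMono φ →
      (∀ᵐ ω ∂P,
        (∑' k : ℕ, ENNReal.ofReal (F (k + 1) ω)) ≤
          Filter.liminf
            (fun J : ℕ => ENNReal.ofReal ((∑ j ∈ Finset.range J, f (φ j) ω) / J))
            atTop) ∧
      (∀ᵐ ω ∂P, (∑' k : ℕ, ENNReal.ofReal (F (k + 1) ω)) = ⊤ →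
        Tendsto (fun J : ℕ => (∑ j ∈ Finset.range J, f (φ j) ω) / J) atTop atTop) := by
  intro φ hφ
  have h_le : ∀ᵐ ω ∂P, (∑' k : ℕ, ENNReal.ofReal (F (k + 1) ω)) ≤
      liminf (fun J : ℕ => ENNReal.ofReal ((∑ j ∈ Finset.range J, f (φ j) ω) / J)) atTop := by
    filter_upwards [ae_all_iff.2 fun k : ℕ => hF (k + 1) k.succ_pos φ hφ] with ω hω
    exact tsum_le_liminf_cesaro (fun j => f (φ j)) ω (fun j => hpos _ ω)
      (fun k => F (k + 1) ω) (fun k => hFpos _ ω) hω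
  refine ⟨h_le, ?_⟩
  filter_upwards [h_le] with ω hω h_top
  exact tendsto_atTop_of_liminf_ofReal_eq_top (top_le_iff.1 (h_top ▸ hω))
end

section
/- (Delbaen–Schachermayer) Let {f_n} be a sequence of nonnegative measurable functions on a probability space (Ω, F, P). Then there exist a measurable function f* : Ω → [0, ∞] and, for each n ∈ ℕ, a function g_n that is a finite convex combination of f_n, f_{n+1}, f_{n+2}, … (i.e. g_n = Σ_{i=n}^{N_n} λ_i^{(n)} f_i with λ_i^{(n)} ≥ 0 and Σ_{i=n}^{N_n} λ_i^{(n)} = 1), such that g_n → f* P-a.e. as n → ∞. -/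
open MeasureTheory Filter Finset
open scoped ENNReal

/-- Weights of finite convex combinations supported on the indices `≥ n`. -/
def tailWeights (n : ℕ) : Set (ℕ →₀ ℝ) :=
  {l | (∀ i, 0 ≤ l i) ∧ (∀ i < n, l i = 0) ∧
    Finsupp.linearCombination ℝ (fun _ : ℕ => (1 : ℝ)) l = 1}

lemma tailWeights_antitone : Antitone tailWeights :=
  fun _ _ h _ hl => ⟨hl.1, fun i hi => hl.2.1 i (hi.trans_le h), hl.2.2⟩

lemma single_mem_tailWeights (n : ℕ) : Finsupp.single n (1 : ℝ) ∈ tailWeights n := by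
  refine ⟨fun i => ?_, fun i hi => ?_, by simp⟩
  · rw [Finsupp.single_apply]; split_ifs <;> norm_num
  · simp [hi.ne']

lemma midpoint_mem_tailWeights {n : ℕ} {l l' : ℕ →₀ ℝ} (hl : l ∈ tailWeights n)
    (hl' : l' ∈ tailWeights n) : (1 / 2 : ℝ) • (l + l') ∈ tailWeights n := by
  refine ⟨fun i => ?_, fun i hi => ?_, ?_⟩
  · have h₁ := hl.1 i
    have h₂ := hl'.1 i
    simp only [Finsupp.smul_apply, Finsupp.add_apply, smul_eq_mul]
    positivity
  · simp [hl.2.1 i hi, hl'.2.1 i hi]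
  · rw [map_smul, map_add, hl.2.2, hl'.2.2]; norm_num

lemma linearCombination_fun_apply {Ω : Type*} {f : ℕ → Ω → ℝ} (l : ℕ →₀ ℝ) (ω : Ω) :
    Finsupp.linearCombination ℝ f l ω = ∑ i ∈ l.support, l i * f i ω := by
  simp [Finsupp.linearCombination_apply, Finsupp.sum, Finset.sum_apply]

lemma linearCombination_fun_nonneg {Ω : Type*} {f : ℕ → Ω → ℝ} (hpos : ∀ n ω, 0 ≤ f n ω)
    {l : ℕ →₀ ℝ} (hl : ∀ i, 0 ≤ l i) (ω : Ω) : 0 ≤ Finsupp.linearCombination ℝ f l ω := by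
  rw [linearCombination_fun_apply]
  exact Finset.sum_nonneg fun i _ => mul_nonneg (hl i) (hpos i ω)

section ExpIntegral

variable {Ω : Type*} [MeasurableSpace Ω] {P : Measure Ω} {f : ℕ → Ω → ℝ}

lemma measurable_linearCombination_fun (hmeas : ∀ n, Measurable (f n)) (l : ℕ →₀ ℝ) :
    Measurable (Finsupp.linearCombination ℝ f l) := by
  have : Finsupp.linearCombination ℝ f l = fun ω => ∑ i ∈ l.support, l i * f i ω :=
    funext (linearCombination_fun_apply l)
  rw [this]
  exact Finset.measurable_sum _ fun i _ => (hmeas i).const_mul _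

lemma integrable_exp_neg [IsFiniteMeasure P] {g : Ω → ℝ} (hg : Measurable g) (hg0 : ∀ ω, 0 ≤ g ω) :
    Integrable (fun ω => Real.exp (-g ω)) P := by
  refine Integrable.of_bound (C := 1) (by fun_prop) (ae_of_all _ fun ω => ?_)
  rw [Real.norm_eq_abs, Real.abs_exp, Real.exp_le_one_iff]
  linarith [hg0 ω]

lemma integral_sq_exp_sub_exp [IsFiniteMeasure P] {g h : Ω → ℝ} (hg : Measurable g)
    (hh : Measurable h) (hg0 : ∀ ω, 0 ≤ g ω) (hh0 : ∀ ω, 0 ≤ h ω) :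
    Integrable (fun ω => (Real.exp (-(g ω / 2)) - Real.exp (-(h ω / 2))) ^ 2) P ∧
    ∫ ω, (Real.exp (-(g ω / 2)) - Real.exp (-(h ω / 2))) ^ 2 ∂P =
      ∫ ω, Real.exp (-g ω) ∂P + ∫ ω, Real.exp (-h ω) ∂P
        - 2 * ∫ ω, Real.exp (-((1 / 2) * (g ω + h ω))) ∂P := by
  have key : (fun ω => (Real.exp (-(g ω / 2)) - Real.exp (-(h ω / 2))) ^ 2) = fun ω =>
      Real.exp (-g ω) + Real.exp (-h ω) - 2 * Real.exp (-((1 / 2) * (g ω + h ω))) := by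
    funext ω
    rw [sub_sq, ← Real.exp_nat_mul, ← Real.exp_nat_mul, mul_assoc, ← Real.exp_add]
    push_cast
    ring_nf
  have ig := integrable_exp_neg (P := P) hg hg0
  have ih := integrable_exp_neg (P := P) hh hh0
  have im := integrable_exp_neg (P := P) (g := fun ω => (1 / 2) * (g ω + h ω)) (by fun_prop)
    (fun ω => by have := hg0 ω; have := hh0 ω; positivity)
  rw [key]
  have ia : Integrable (fun ω => Real.exp (-g ω) + Real.exp (-h ω)) P := ig.add ih
  refine ⟨ia.sub (im.const_mul 2), ?_⟩
  rw [integral_sub ia (im.const_mul 2), integral_add ig ih, integral_const_mul]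

/-- Nearly minimizing `E[exp (-g)]` over the tails yields forward convex combinations `g k` for
which `exp (-g k / 2)` is Cauchy in `L²` with geometric rate. -/
lemma exists_tailWeights_integral_sq_le [IsProbabilityMeasure P] (hmeas : ∀ n, Measurable (f n))
    (hpos : ∀ n ω, 0 ≤ f n ω) :
    ∃ w : ℕ → ℕ →₀ ℝ, (∀ n, w n ∈ tailWeights n) ∧ ∀ k n m, k ≤ n → k ≤ m →
      ∫ ω, (Real.exp (-(Finsupp.linearCombination ℝ f (w n) ω / 2))
        - Real.exp (-(Finsupp.linearCombination ℝ f (w m) ω / 2))) ^ 2 ∂P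
        ≤ 4 * (1 / 4 : ℝ) ^ k := by
  set E : (ℕ →₀ ℝ) → ℝ := fun l => ∫ ω, Real.exp (-(Finsupp.linearCombination ℝ f l ω)) ∂P with hE
  set I : ℕ → ℝ := fun n => sInf (E '' tailWeights n) with hI
  have hbdd : ∀ n, BddBelow (E '' tailWeights n) := fun n =>
    ⟨0, by rintro _ ⟨l, -, rfl⟩; exact integral_nonneg fun ω => (Real.exp_pos _).le⟩
  have hne : ∀ n, (E '' tailWeights n).Nonempty := fun n =>
    ⟨_, Set.mem_image_of_mem _ (single_mem_tailWeights n)⟩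
  have hE1 : ∀ l : ℕ →₀ ℝ, (∀ i, 0 ≤ l i) → E l ≤ 1 := by
    intro l hl
    have h0 := linearCombination_fun_nonneg hpos hl
    calc E l ≤ ∫ _, (1 : ℝ) ∂P := by
          refine integral_mono (integrable_exp_neg (measurable_linearCombination_fun hmeas l) h0)
            (integrable_const _) fun ω => ?_
          simpa using h0 ω
      _ = 1 := by simp
  have hImono : Monotone I := fun a b hab =>
    csInf_le_csInf (hbdd a) (hne b) (Set.image_mono (tailWeights_antitone hab))
  have hIbdd : BddAbove (Set.range I) := by
    refine ⟨1, ?_⟩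
    rintro _ ⟨n, rfl⟩
    exact (csInf_le (hbdd n) (Set.mem_image_of_mem _ (single_mem_tailWeights n))).trans
      (hE1 _ (single_mem_tailWeights n).1)
  set L := ⨆ n, I n
  have hlim : Tendsto I atTop (nhds L) := tendsto_atTop_ciSup hImono hIbdd
  obtain ⟨φ, hφ, hφL⟩ := extraction_forall_of_eventually
    (P := fun k n => L - (1 / 4 : ℝ) ^ k < I n)
    fun k => hlim.eventually_const_lt (sub_lt_self L (by positivity))
  have hex : ∀ k, ∃ l ∈ tailWeights (φ k), E l < L + (1 / 4 : ℝ) ^ k := by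
    intro k
    have : I (φ k) < L + (1 / 4 : ℝ) ^ k :=
      (le_ciSup hIbdd _).trans_lt (lt_add_of_pos_right _ (by positivity))
    obtain ⟨_, ⟨l, hl, rfl⟩, h⟩ := exists_lt_of_csInf_lt (hne _) this
    exact ⟨l, hl, h⟩
  choose w hw hwE using hex
  refine ⟨w, fun n => tailWeights_antitone (hφ.id_le n) (hw n), fun k n m hn hm => ?_⟩
  rw [(integral_sq_exp_sub_exp (measurable_linearCombination_fun hmeas (w n))
    (measurable_linearCombination_fun hmeas (w m)) (linearCombination_fun_nonneg hpos (hw n).1)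
    (linearCombination_fun_nonneg hpos (hw m).1)).2]
  have hmid : I (φ k) ≤ E ((1 / 2 : ℝ) • (w n + w m)) :=
    csInf_le (hbdd _) (Set.mem_image_of_mem _ (midpoint_mem_tailWeights
      (tailWeights_antitone (hφ.monotone hn) (hw n))
      (tailWeights_antitone (hφ.monotone hm) (hw m))))
  simp only [hE, map_smul, map_add, Pi.smul_apply, Pi.add_apply, smul_eq_mul] at hmid
  have hn4 : (1 / 4 : ℝ) ^ n ≤ (1 / 4) ^ k :=
    pow_le_pow_of_le_one (by norm_num) (by norm_num) hn
  have hm4 : (1 / 4 : ℝ) ^ m ≤ (1 / 4) ^ k :=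
    pow_le_pow_of_le_one (by norm_num) (by norm_num) hm
  have h₁ := hwE n
  have h₂ := hwE m
  have h₃ := hφL k
  simp only [hE] at h₁ h₂
  linarith

end ExpIntegral

lemma eLpNorm_two_le_ofReal {Ω : Type*} [MeasurableSpace Ω] {P : Measure Ω} {h : Ω → ℝ}
    (hint : Integrable (fun ω => h ω ^ 2) P) {c : ℝ} (hc : 0 ≤ c)
    (hle : ∫ ω, h ω ^ 2 ∂P ≤ c ^ 2) : eLpNorm h 2 P ≤ ENNReal.ofReal c := by
  rw [eLpNorm_eq_lintegral_rpow_enorm_toReal (by norm_num) (by norm_num)]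
  have h1 : ∀ ω, ‖h ω‖ₑ ^ (2 : ℝ≥0∞).toReal = ENNReal.ofReal (h ω ^ 2) := fun ω => by
    rw [Real.enorm_eq_ofReal_abs, ENNReal.toReal_ofNat, ENNReal.rpow_ofNat,
      ← ENNReal.ofReal_pow (abs_nonneg _), sq_abs]
  simp_rw [h1]
  rw [← ofReal_integral_eq_lintegral_ofReal hint (ae_of_all _ fun ω => sq_nonneg _)]
  rw [ENNReal.toReal_ofNat, ENNReal.ofReal_rpow_of_nonneg (integral_nonneg fun ω => sq_nonneg _)
    (by norm_num), ← Real.sqrt_eq_rpow]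
  exact ENNReal.ofReal_le_ofReal (Real.sqrt_le_iff.2 ⟨hc, hle⟩)

lemma exists_tendsto_ofReal_of_tendsto_exp {x : ℕ → ℝ} {a : ℝ}
    (h : Tendsto (fun n => Real.exp (-(x n / 2))) atTop (nhds a)) :
    ∃ b : ℝ≥0∞, Tendsto (fun n => ENNReal.ofReal (x n)) atTop (nhds b) := by
  rcases eq_or_ne a 0 with rfl | ha
  · refine ⟨⊤, ENNReal.tendsto_ofReal_atTop.comp ?_⟩
    have h2 := tendsto_neg_atBot_atTop.comp (Real.tendsto_exp_comp_nhds_zero.1 h)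
    refine (h2.atTop_mul_const (r := 2) (by norm_num)).congr fun n => ?_
    simp
  · refine ⟨ENNReal.ofReal (-2 * Real.log a), ENNReal.tendsto_ofReal ?_⟩
    refine ((h.log ha).const_mul (-2)).congr fun n => ?_
    rw [Real.log_exp]
    ring

/-- **Delbaen–Schachermayer.** For any sequence of nonnegative measurable functions
`{f_n}` there exist a measurable `fstar : Ω → [0,∞]` and forward convex combinations
`g_n ∈ conv(f_n, f_{n+1}, …)` such that `g_n → fstar` `P`-a.e. -/
theorem delbaen_schachermayer {Ω : Type*} [MeasurableSpace Ω] (P : Measure Ω)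
    [IsProbabilityMeasure P] (f : ℕ → Ω → ℝ)
    (hmeas : ∀ n, Measurable (f n)) (hpos : ∀ n ω, 0 ≤ f n ω) :
    ∃ fstar : Ω → ℝ≥0∞, Measurable fstar ∧
      ∃ (g : ℕ → Ω → ℝ) (N : ℕ → ℕ) (lam : ℕ → ℕ → ℝ),
        (∀ n, n ≤ N n) ∧
        (∀ n, ∀ i ∈ Finset.Icc n (N n), 0 ≤ lam n i) ∧
        (∀ n, ∑ i ∈ Finset.Icc n (N n), lam n i = 1) ∧
        (∀ n ω, g n ω = ∑ i ∈ Finset.Icc n (N n), lam n i * f i ω) ∧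
        ∀ᵐ ω ∂P, Tendsto (fun n : ℕ => ENNReal.ofReal (g n ω)) atTop (nhds (fstar ω)) := by
  obtain ⟨w, hw, hcau⟩ := exists_tailWeights_integral_sq_le (P := P) hmeas hpos
  set g : ℕ → Ω → ℝ := fun n => Finsupp.linearCombination ℝ f (w n) with hg
  have hgm : ∀ n, Measurable (g n) := fun n => measurable_linearCombination_fun hmeas (w n)
  have hg0 : ∀ n ω, 0 ≤ g n ω := fun n => linearCombination_fun_nonneg hpos (hw n).1
  have hsupp : ∀ n, (w n).support ⊆ Finset.Icc n (max n ((w n).support.sup id)) := by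
    intro n i hi
    refine Finset.mem_Icc.2 ⟨?_, le_max_of_le_right (Finset.le_sup (f := id) hi)⟩
    by_contra! hlt
    exact Finsupp.mem_support_iff.1 hi ((hw n).2.1 i hlt)
  refine ⟨fun ω => liminf (fun n => ENNReal.ofReal (g n ω)) atTop,
    Measurable.liminf fun n => (hgm n).ennreal_ofReal, g,
    fun n => max n ((w n).support.sup id), fun n i => w n i, fun n => le_max_left _ _,
    fun n i _ => (hw n).1 i, fun n => ?_, fun n ω => ?_, ?_⟩
  · have h := (hw n).2.2
    rw [Finsupp.linearCombination_apply, Finsupp.sum_of_support_subset _ (hsupp n) _ (by simp)] at h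
    simpa using h
  · rw [hg]
    simp only [linearCombination_fun_apply]
    refine Finset.sum_subset (hsupp n) fun i _ hi => ?_
    rw [Finsupp.notMem_support_iff.1 hi, zero_mul]
  · have hB : ∑' k : ℕ, ENNReal.ofReal (3 * (1 / 2 : ℝ) ^ k) ≠ ∞ :=
      ((summable_geometric_of_lt_one (by norm_num) (by norm_num)).mul_left 3).tsum_ofReal_ne_top
    have hae := Lp.ae_tendsto_of_cauchy_eLpNorm (μ := P) (p := 2)
      (f := fun n ω => Real.exp (-(g n ω / 2)))
      (fun n => by have := hgm n; fun_prop) (by norm_num) hB fun k n m hn hm => ?_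
    · filter_upwards [hae] with ω ⟨a, ha⟩
      obtain ⟨b, hb⟩ := exists_tendsto_ofReal_of_tendsto_exp ha
      rwa [hb.liminf_eq]
    · have hpk : (0 : ℝ) < (1 / 2) ^ k := by positivity
      refine (eLpNorm_two_le_ofReal (c := 2 * (1 / 2 : ℝ) ^ k)
        (integral_sq_exp_sub_exp (hgm n) (hgm m) (hg0 n) (hg0 m)).1 (by positivity) ?_).trans_lt
        ((ENNReal.ofReal_lt_ofReal_iff (by positivity)).2 (by linarith))
      refine (hcau k n m hn hm).trans_eq ?_
      rw [mul_pow, ← pow_mul, mul_comm k 2, pow_mul]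
      norm_num
end
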